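/- arXiv:1008.3408 — 15 statements merged into one kernel-verified Lean document; each statement's English description precedes it below -/
import Mathlib

section
/- Let F be a finite field with q elements and m a positive integer. Let f be a probability mass function on F^m. If for every nonzero vector u ∈ F^m and every scalar c ∈ F one has ∑_{v ∈ F^m : u·v = c} f(v) = 1/q (i.e. the dot product u·ṽ is uniformly distributed over F for every nonzero u), then f(v) = q^{-m} for every v ∈ F^m (i.e. ṽ is uniformly distributed over F^m). -/
open Matrix

/-- `f` is a probability mass function on a finite type `X`. -/
def IsPmf {X : Type*} [Fintype X] (f : X → ℝ) : Prop :=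
  (∀ x, 0 ≤ f x) ∧ ∑ x, f x = 1

theorem card_dot_aux {F : Type*} [Field F] [Fintype F] [DecidableEq F] (m : ℕ)
    (d : Fin m → F) (hd : d ≠ 0) :
    (Finset.univ.filter fun u : Fin m → F => u ⬝ᵥ d = 0).card * Fintype.card F
      = Fintype.card F ^ m := by
  let φ : (Fin m → F) →+ F :=
    { toFun := fun u => u ⬝ᵥ d
      map_zero' := zero_dotProduct d
      map_add' := fun a b => add_dotProduct a b d }
  have hs : Function.Surjective φ := by
    intro c
    obtain ⟨i, hi⟩ := Function.ne_iff.mp hd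
    have hi' : d i ≠ 0 := hi
    refine ⟨Pi.single i (c * (d i)⁻¹), ?_⟩
    change Pi.single i (c * (d i)⁻¹) ⬝ᵥ d = c
    rw [single_dotProduct]
    field_simp
  have hfib : ∀ c : F, (Finset.univ.filter fun u : Fin m → F => u ⬝ᵥ d = c).card =
      (Finset.univ.filter fun u : Fin m → F => u ⬝ᵥ d = 0).card := by
    intro c
    exact AddMonoidHom.card_fiber_eq_of_mem_range φ (hs c) (hs 0)
  have key := Finset.card_eq_sum_card_fiberwise (s := (Finset.univ : Finset (Fin m → F)))
    (t := (Finset.univ : Finset F)) (f := fun u => u ⬝ᵥ d) (fun _ _ => by simp)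
  rw [Finset.sum_congr rfl (fun c _ => hfib c)] at key
  simp only [Finset.sum_const, Finset.card_univ, smul_eq_mul, Fintype.card_fun,
    Fintype.card_fin] at key
  rw [key, mul_comm]

/-- If the dot product `u ⬝ᵥ ṽ` is uniformly distributed over `F` for every nonzero
`u ∈ F^m`, then `ṽ` is uniformly distributed over `F^m`. -/
theorem stmt0 {F : Type*} [Field F] [Fintype F] [DecidableEq F] (q m : ℕ)
    (hq : Fintype.card F = q) (hm : 0 < m)
    (f : (Fin m → F) → ℝ) (hf : IsPmf f)
    (h : ∀ u : Fin m → F, u ≠ 0 → ∀ c : F,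
      ∑ v ∈ Finset.univ.filter fun v : Fin m → F => u ⬝ᵥ v = c, f v = (q : ℝ)⁻¹) :
    ∀ v : Fin m → F, f v = ((q : ℝ) ^ m)⁻¹ := by
  intro w
  obtain ⟨-, h1⟩ := hf
  have hq1 : (1 : ℝ) < q := by
    rw [← hq]; exact_mod_cast Fintype.one_lt_card
  have hq0 : (q : ℝ) ≠ 0 := by positivity
  have hA : ∑ u : Fin m → F, ∑ v : Fin m → F, (if u ⬝ᵥ v = u ⬝ᵥ w then f v else 0)
      = 1 + ((q : ℝ) ^ m - 1) * (q : ℝ)⁻¹ := by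
    have e : ∀ u : Fin m → F, ∑ v : Fin m → F, (if u ⬝ᵥ v = u ⬝ᵥ w then f v else 0)
        = (q : ℝ)⁻¹ + if u = 0 then 1 - (q : ℝ)⁻¹ else 0 := by
      intro u
      by_cases hu : u = 0
      · subst hu; simp [h1]
      · rw [← Finset.sum_filter, h u hu]; simp [hu]
    rw [Finset.sum_congr rfl (fun u _ => e u), Finset.sum_add_distrib]
    simp [hq]
    ring
  have hB : ∑ u : Fin m → F, ∑ v : Fin m → F, (if u ⬝ᵥ v = u ⬝ᵥ w then f v else 0)
      = (q : ℝ) ^ m * (q : ℝ)⁻¹ + f w * ((q : ℝ) ^ m - (q : ℝ) ^ m * (q : ℝ)⁻¹) := by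
    rw [Finset.sum_comm]
    have e : ∀ v : Fin m → F, ∑ u : Fin m → F, (if u ⬝ᵥ v = u ⬝ᵥ w then f v else 0)
        = f v * ((q : ℝ) ^ m * (q : ℝ)⁻¹) +
          if v = w then f w * ((q : ℝ) ^ m - (q : ℝ) ^ m * (q : ℝ)⁻¹) else 0 := by
      intro v
      by_cases hv : v = w
      · subst hv; simp [hq]; ring
      · have hc := card_dot_aux m (v - w) (sub_ne_zero.mpr hv)
        simp only [dotProduct_sub, sub_eq_zero] at hc
        rw [hq] at hc
        have hc' : ((Finset.univ.filter fun u : Fin m → F => u ⬝ᵥ v = u ⬝ᵥ w).card : ℝ) * q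
          = (q : ℝ) ^ m := by exact_mod_cast hc
        rw [← Finset.sum_filter, Finset.sum_const, nsmul_eq_mul, if_neg hv, ← hc']
        field_simp
        ring
    rw [Finset.sum_congr rfl (fun v _ => e v), Finset.sum_add_distrib, ← Finset.sum_mul, h1]
    simp
  rw [hA] at hB
  have hp : (q : ℝ) ^ m ≠ 0 := pow_ne_zero _ hq0
  have hq2 : (q : ℝ) - 1 ≠ 0 := by linarith
  apply eq_inv_of_mul_eq_one_left
  apply mul_right_cancel₀ hq2
  field_simp at hB
  linarith
end

section
/- Let F be a finite field with q elements and m, n positive integers. A pmf f on F^{m×n} is good if and only if the transposed pmf fᵀ on F^{n×m}, defined by fᵀ(B) = f(Bᵀ), is good. -/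
open Matrix

/-- A pmf `f` on the space of `m × n` matrices over a finite field `F` (with `q` elements)
is `k`-good if for every full-rank `M ∈ F^{k×m}` and every `K ∈ F^{k×n}`,
`∑_{A : M*A = K} f A = q^{-kn}`. -/
def IsKGood (q k : ℕ) {F : Type*} [Field F] [Fintype F] [DecidableEq F] {m n : ℕ}
    (f : Matrix (Fin m) (Fin n) F → ℝ) : Prop :=
  ∀ M : Matrix (Fin k) (Fin m) F, M.rank = k →
    ∀ K : Matrix (Fin k) (Fin n) F,
      ∑ A ∈ Finset.univ.filter fun A : Matrix (Fin m) (Fin n) F => M * A = K, f A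
        = ((q : ℝ) ^ (k * n))⁻¹

lemma isKGood_one_iff {F : Type*} [Field F] [Fintype F] [DecidableEq F] (q m n : ℕ)
    (f : Matrix (Fin m) (Fin n) F → ℝ) :
    IsKGood q 1 f ↔ ∀ u : Fin m → F, u ≠ 0 → ∀ v : Fin n → F,
      ∑ A : Matrix (Fin m) (Fin n) F, (if u ᵥ* A = v then f A else 0) = ((q : ℝ) ^ n)⁻¹ := by
  have key : ∀ (M : Matrix (Fin 1) (Fin m) F) (A : Matrix (Fin m) (Fin n) F)
      (K : Matrix (Fin 1) (Fin n) F), M * A = K ↔ (M 0) ᵥ* A = K 0 := by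
    intro M A K
    constructor
    · rintro rfl
      ext j
      simp [Matrix.mul_apply, Matrix.vecMul, dotProduct]
    · intro h
      ext i j
      have := congrFun h j
      rw [Subsingleton.elim i 0, ← this]
      simp [Matrix.mul_apply, Matrix.vecMul, dotProduct]
  unfold IsKGood
  constructor
  · intro h u hu v
    have hr : (Matrix.of (fun _ : Fin 1 => u)).rank = 1 := by
      apply le_antisymm
      · simpa using Matrix.rank_le_card_height (Matrix.of (fun _ : Fin 1 => u))
      · rw [Nat.one_le_iff_ne_zero]
        intro h0
        rw [Matrix.rank, Submodule.finrank_eq_zero, LinearMap.range_eq_bot] at h0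
        apply hu
        ext j
        have h2 := congrFun (LinearMap.congr_fun h0 (Pi.single j 1)) 0
        simpa using h2
    have := h _ hr (Matrix.of (fun _ : Fin 1 => v))
    simp only [key, one_mul] at this
    rw [← this, Finset.sum_filter]
    rfl
  · intro h M hM K
    have hu : M 0 ≠ 0 := by
      intro h0
      have : M = 0 := by
        ext i j
        rw [Subsingleton.elim i 0, h0]; rfl
      rw [this, Matrix.rank_zero] at hM
      omega
    have := h _ hu (K 0)
    simp only [key, one_mul]
    rw [← this, Finset.sum_filter]

lemma card_hyper {F : Type*} [Field F] [Fintype F] [DecidableEq F] (n : ℕ)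
    (w : Fin n → F) (hw : w ≠ 0) (c : F) :
    (∑ v : Fin n → F, (if v ⬝ᵥ w = c then (1:ℝ) else 0)) =
      (Fintype.card F : ℝ) ^ n / (Fintype.card F : ℝ) := by
  obtain ⟨i, hi⟩ := Function.ne_iff.mp hw
  have hi : w i ≠ 0 := hi
  have htr : ∀ d : F, (∑ v : Fin n → F, (if v ⬝ᵥ w = d then (1:ℝ) else 0)) =
      ∑ v : Fin n → F, (if v ⬝ᵥ w = c then (1:ℝ) else 0) := by
    intro d
    refine Fintype.sum_equiv (Equiv.addRight (Pi.single i ((c - d) / w i))) _ _ ?_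
    intro v
    have : (v + Pi.single i ((c - d) / w i)) ⬝ᵥ w = v ⬝ᵥ w + (c - d) := by
      rw [add_dotProduct, single_dotProduct, div_mul_cancel₀ _ hi]
    simp only [Equiv.coe_addRight, this]
    congr 1
    apply propext
    constructor <;> intro h
    · rw [h]; ring
    · linear_combination h
  have hsum : ∑ d : F, (∑ v : Fin n → F, (if v ⬝ᵥ w = d then (1:ℝ) else 0)) =
      (Fintype.card F : ℝ) ^ n := by
    rw [Finset.sum_comm]
    simp
  rw [Finset.sum_congr rfl (fun d _ => htr d)] at hsum
  have hq : (Fintype.card F : ℝ) ≠ 0 := by exact_mod_cast Fintype.card_ne_zero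
  rw [eq_div_iff hq, ← hsum]
  simp [mul_comm]

lemma good_transpose {F : Type*} [Field F] [Fintype F] [DecidableEq F] (q m n : ℕ)
    (hq : Fintype.card F = q)
    (f : Matrix (Fin m) (Fin n) F → ℝ) (hf : ∑ x, f x = 1)
    (h : IsKGood q 1 f) : IsKGood q 1 (fun B : Matrix (Fin n) (Fin m) F => f B.transpose) := by
  rw [isKGood_one_iff] at h ⊢
  intro w hw v
  have hcast : (Fintype.card F : ℝ) = q := by rw [hq]
  have hq1 : (1:ℝ) < q := by rw [← hq]; exact_mod_cast Fintype.one_lt_card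
  have hq0 : (q:ℝ) ≠ 0 := by positivity
  have e1 : ∑ B : Matrix (Fin n) (Fin m) F, (if w ᵥ* B = v then f Bᵀ else 0) =
      ∑ A : Matrix (Fin m) (Fin n) F, (if A *ᵥ w = v then f A else 0) := by
    refine Fintype.sum_equiv (Matrix.transposeAddEquiv (Fin n) (Fin m) F).toEquiv _ _ ?_
    intro B
    simp [Matrix.mulVec_transpose]
  rw [e1]
  set S := ∑ A : Matrix (Fin m) (Fin n) F, (if A *ᵥ w = v then f A else 0) with hS
  have hline : ∀ u : Fin m → F, u ≠ 0 → ∀ c : F,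
      ∑ A : Matrix (Fin m) (Fin n) F, (if u ⬝ᵥ (A *ᵥ w) = c then f A else 0) = 1 / q := by
    intro u hu c
    have : ∀ A : Matrix (Fin m) (Fin n) F, (if u ⬝ᵥ (A *ᵥ w) = c then f A else 0) =
        ∑ y : Fin n → F, (if y ⬝ᵥ w = c then (1:ℝ) else 0) * (if u ᵥ* A = y then f A else 0) := by
      intro A
      simp [Matrix.dotProduct_mulVec]
    simp only [this]
    rw [Finset.sum_comm]
    simp only [← Finset.mul_sum, h u hu]
    rw [← Finset.sum_mul, card_hyper n w hw c, hcast]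
    field_simp
  have hT1 : ∑ u : Fin m → F, ∑ A : Matrix (Fin m) (Fin n) F,
      (if u ⬝ᵥ (A *ᵥ w) = u ⬝ᵥ v then f A else 0) = 1 + ((q:ℝ)^m - 1) * (1 / q) := by
    have : ∀ u : Fin m → F, ∑ A : Matrix (Fin m) (Fin n) F,
      (if u ⬝ᵥ (A *ᵥ w) = u ⬝ᵥ v then f A else 0) = 1/q + (if u = 0 then (1 - 1/q : ℝ) else 0) := by
      intro u
      by_cases hu : u = 0
      · subst hu; simp [hf]
      · rw [hline u hu]; simp [hu]
    simp only [this, Finset.sum_add_distrib]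
    simp [hcast]
    ring
  have hT2 : ∑ u : Fin m → F, ∑ A : Matrix (Fin m) (Fin n) F,
      (if u ⬝ᵥ (A *ᵥ w) = u ⬝ᵥ v then f A else 0) =
      (q:ℝ)^m / q + ((q:ℝ)^m - (q:ℝ)^m / q) * S := by
    rw [Finset.sum_comm]
    have : ∀ A : Matrix (Fin m) (Fin n) F, ∑ u : Fin m → F,
      (if u ⬝ᵥ (A *ᵥ w) = u ⬝ᵥ v then f A else 0) = (q:ℝ)^m / q * f A +
        ((q:ℝ)^m - (q:ℝ)^m / q) * (if A *ᵥ w = v then f A else 0) := by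
      intro A
      by_cases hA : A *ᵥ w = v
      · simp [hA, hcast]; ring
      · have h2 := card_hyper m (A *ᵥ w - v) (sub_ne_zero.mpr hA) 0
        simp only [dotProduct_sub, sub_eq_zero, hcast] at h2
        rw [← h2, Finset.sum_mul]
        simp [hA]
    simp only [this, Finset.sum_add_distrib, ← Finset.mul_sum, hf, mul_one, ← hS]
  rw [hT1] at hT2
  have h1 : ((q:ℝ) - 1) ≠ 0 := by linarith
  have hqm : (q:ℝ)^m ≠ 0 := pow_ne_zero _ hq0
  field_simp at hT2
  have : ((q:ℝ) - 1) * ((q:ℝ)^m * S - 1) = 0 := by linear_combination -hT2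
  have h3 := (mul_eq_zero.mp this).resolve_left h1
  apply eq_inv_of_mul_eq_one_left
  linarith

/-- A pmf on `F^{m×n}` is good (= `1`-good) iff its transpose is good. -/
theorem stmt1 {F : Type*} [Field F] [Fintype F] [DecidableEq F] (q m n : ℕ)
    (hq : Fintype.card F = q) (hm : 0 < m) (hn : 0 < n)
    (f : Matrix (Fin m) (Fin n) F → ℝ) (hf : IsPmf f) :
    IsKGood q 1 f ↔ IsKGood q 1 (fun B : Matrix (Fin n) (Fin m) F => f B.transpose) := by
  constructor
  · exact good_transpose q m n hq f hf.2
  · intro h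
    have hs : ∑ B : Matrix (Fin n) (Fin m) F, f Bᵀ = 1 := by
      rw [← hf.2]
      exact Fintype.sum_equiv (Matrix.transposeAddEquiv (Fin n) (Fin m) F).toEquiv _ _
        (fun B => rfl)
    exact good_transpose q n m hq _ hs h
end

section
/- Let F be a finite field with q elements and k, m, n positive integers with k ≤ m ≤ n. A subset 𝒜 ⊆ F^{m×n} is an (m,n,k) MRD code if and only if |𝒜| = q^{kn} and for every matrix B ∈ F^{k×m} of rank k one has {B*A : A ∈ 𝒜} = F^{k×n}. -/
open Matrix

/-- The rank distance of a set of matrices: the minimum of `rank (X - Y)` over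
distinct `X, Y` in the set. -/
noncomputable def rankDist {F : Type*} [Field F] [Fintype F] {m n : ℕ}
    (𝒜 : Set (Matrix (Fin m) (Fin n) F)) : ℕ :=
  sInf {r : ℕ | ∃ X ∈ 𝒜, ∃ Y ∈ 𝒜, X ≠ Y ∧ (X - Y).rank = r}

/-- An `(m,n,k)` MRD code over the field `F` with `q` elements: a set of
`q^(k * max m n)` matrices in `F^{m×n}` with rank distance `min m n - k + 1`. -/
def IsMRD (q k : ℕ) {F : Type*} [Field F] [Fintype F] {m n : ℕ}
    (𝒜 : Set (Matrix (Fin m) (Fin n) F)) : Prop :=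
  𝒜.ncard = q ^ (k * max m n) ∧ rankDist 𝒜 = min m n - k + 1

theorem ncard_univ_matrix {F : Type*} [Field F] [Fintype F] (k n : ℕ) :
    (Set.univ : Set (Matrix (Fin k) (Fin n) F)).ncard = Fintype.card F ^ (k * n) := by
  rw [Set.ncard_univ, Matrix, Nat.card_fun, Nat.card_fun, Nat.card_eq_fintype_card (α := F),
    ← pow_mul]
  simp [mul_comm]

theorem exists_left_annihilator {F : Type*} [Field F] {k m n : ℕ}
    (M : Matrix (Fin m) (Fin n) F) (h : M.rank + k ≤ m) :
    ∃ B : Matrix (Fin k) (Fin m) F, B.rank = k ∧ B * M = 0 := by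
  have h1 := Mᵀ.mulVecLin.finrank_range_add_finrank_ker
  have h2 : Module.finrank F (LinearMap.range Mᵀ.mulVecLin) = M.rank := by
    rw [← Matrix.rank_transpose M]; rfl
  rw [h2, Module.finrank_fin_fun] at h1
  obtain ⟨f, hf⟩ := exists_linearIndependent_of_le_finrank
    (R := F) (M := LinearMap.ker Mᵀ.mulVecLin) (n := k) (by omega)
  refine ⟨Matrix.of fun i => (f i : Fin m → F), ?_, ?_⟩
  · have h3 : LinearIndependent F (Matrix.of fun i => (f i : Fin m → F)).row :=
      hf.map' (Submodule.subtype _) (Submodule.ker_subtype _)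
    simpa using h3.rank_matrix
  · ext i j
    have h4 := (f i).2
    rw [LinearMap.mem_ker, Matrix.mulVecLin_apply, Matrix.mulVec_transpose] at h4
    exact congrFun h4 j

theorem exists_small_rank {F : Type*} [Field F] [Fintype F] {k m n : ℕ}
    (hk : 0 < k) (hkm : k ≤ m) (hmn : m ≤ n) (𝒜 : Set (Matrix (Fin m) (Fin n) F))
    (hc : 𝒜.ncard = Fintype.card F ^ (k * n)) :
    ∃ X ∈ 𝒜, ∃ Y ∈ 𝒜, X ≠ Y ∧ (X - Y).rank ≤ m - k + 1 := by
  classical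
  obtain ⟨B, hB, -⟩ := exists_left_annihilator (F := F) (k := k - 1)
    (0 : Matrix (Fin m) (Fin n) F) (by rw [Matrix.rank_zero]; omega)
  have hlt : (Set.univ : Set (Matrix (Fin (k - 1)) (Fin n) F)).ncard < 𝒜.ncard := by
    rw [hc, ncard_univ_matrix]
    apply Nat.pow_lt_pow_right Fintype.one_lt_card
    exact Nat.mul_lt_mul_of_pos_right (by omega) (by omega)
  obtain ⟨X, hX, Y, hY, hne, he⟩ := Set.exists_ne_map_eq_of_ncard_lt_of_maps_to hlt
    (f := fun A => B * A) (fun _ _ => Set.mem_univ _)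
  refine ⟨X, hX, Y, hY, hne, ?_⟩
  have := Matrix.rank_add_rank_le_card_of_mul_eq_zero (A := B) (B := X - Y)
    (by rw [Matrix.mul_sub]; exact sub_eq_zero.2 he)
  rw [Fintype.card_fin] at this
  omega

/-- For `k ≤ m ≤ n`, a set `𝒜 ⊆ F^{m×n}` is an `(m,n,k)` MRD code iff
`|𝒜| = q^{kn}` and `B𝒜 = F^{k×n}` for every full-rank `B ∈ F^{k×m}`. -/
theorem stmt2 {F : Type*} [Field F] [Fintype F] [DecidableEq F] (q k m n : ℕ)
    (hq : Fintype.card F = q) (hk : 0 < k) (hkm : k ≤ m) (hmn : m ≤ n)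
    (𝒜 : Set (Matrix (Fin m) (Fin n) F)) :
    IsMRD q k 𝒜 ↔
      (𝒜.ncard = q ^ (k * n) ∧
        ∀ B : Matrix (Fin k) (Fin m) F, B.rank = k →
          (fun A => B * A) '' 𝒜 = (Set.univ : Set (Matrix (Fin k) (Fin n) F))) := by
  classical
  subst hq
  unfold IsMRD
  rw [max_eq_right hmn, min_eq_left hmn]
  refine and_congr_right fun hc => ?_
  have hcard : (Set.univ : Set (Matrix (Fin k) (Fin n) F)).ncard
      = Fintype.card F ^ (k * n) := ncard_univ_matrix k n
  constructor
  · intro hd B hB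
    apply Set.eq_of_subset_of_ncard_le (Set.subset_univ _)
    rw [hcard, ← hc, Set.InjOn.ncard_image]
    intro X hX Y hY he
    by_contra hne
    have h1 : rankDist 𝒜 ≤ (X - Y).rank := Nat.sInf_le ⟨X, hX, Y, hY, hne, rfl⟩
    have := Matrix.rank_add_rank_le_card_of_mul_eq_zero (A := B) (B := X - Y)
      (by rw [Matrix.mul_sub]; exact sub_eq_zero.2 he)
    rw [Fintype.card_fin] at this
    omega
  · intro h
    obtain ⟨X, hX, Y, hY, hne, hr⟩ := exists_small_rank hk hkm hmn 𝒜 hc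
    apply le_antisymm
    · exact le_trans (Nat.sInf_le ⟨X, hX, Y, hY, hne, rfl⟩) hr
    · refine le_csInf ⟨(X - Y).rank, X, hX, Y, hY, hne, rfl⟩ ?_
      rintro r ⟨X, hX, Y, hY, hne, rfl⟩
      by_contra hlt
      obtain ⟨B, hB, h0⟩ := exists_left_annihilator (k := k) (X - Y) (by omega)
      have hinj : Set.InjOn (fun A => B * A) 𝒜 := by
        refine Set.injOn_of_ncard_image_eq ?_ (Set.toFinite _)
        rw [h B hB, hcard, hc]
      apply hne
      apply hinj hX hY
      rw [Matrix.mul_sub] at h0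
      exact sub_eq_zero.1 h0
end

section
/- Let F be a finite field with q elements, let k, m, n be positive integers with k ≤ min(m,n), and let 𝒜 ⊆ F^{m×n} be an (m,n,k) MRD code. Then the uniform distribution on 𝒜 is a good pmf; equivalently, for every nonzero vector u ∈ F^m and every vector v ∈ F^n, the number of matrices A ∈ 𝒜 with u*A = v equals |𝒜| / q^n = q^{k·max(m,n) − n}. -/
open Matrix

lemma rank_bound {F : Type*} [Field F] {m n : ℕ}
    (u : Fin m → F) (j : Fin m) (hj : u j ≠ 0) (T : Finset (Fin m)) (hT : j ∉ T)
    (D : Matrix (Fin m) (Fin n) F) (hu : u ᵥ* D = 0) (hD : ∀ i ∈ T, D i = 0) :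
    D.rank + (T.card + 1) ≤ m := by
  classical
  have hrow : ∑ i, u i • D i = 0 := by
    rw [← hu]; ext x; simp [vecMul, dotProduct]
  set R : Finset (Fin m) := (insert j T)ᶜ with hR
  have hRc : R.card + (T.card + 1) = m := by
    have h1 := Finset.card_compl_add_card (insert j T)
    rw [Finset.card_insert_of_notMem hT] at h1
    simpa [hR] using h1
  set W := Submodule.span F ((R.image D.row : Finset (Fin n → F)) : Set (Fin n → F)) with hW
  have hmemR : ∀ i ∈ R, D i ∈ W := fun i hi =>
    Submodule.subset_span (by
      rw [Finset.mem_coe]; exact Finset.mem_image_of_mem D.row hi)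
  have hne : ∀ i, i ≠ j → D i ∈ W := by
    intro i hi
    by_cases hiT : i ∈ T
    · rw [hD i hiT]; exact W.zero_mem
    · exact hmemR i (by simp [hR, hi, hiT])
  have hjm : D j ∈ W := by
    have h2 : u j • D j = - ∑ i ∈ Finset.univ.erase j, u i • D i := by
      rw [← Finset.add_sum_erase _ _ (Finset.mem_univ j)] at hrow
      exact eq_neg_of_add_eq_zero_left hrow
    have h3 : u j • D j ∈ W := by
      rw [h2]
      exact W.neg_mem (W.sum_mem fun i hi => W.smul_mem _ (hne i (Finset.ne_of_mem_erase hi)))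
    exact (W.smul_mem_iff hj).1 h3
  have hle : Submodule.span F (Set.range D.row) ≤ W := by
    rw [Submodule.span_le]
    rintro _ ⟨i, rfl⟩
    by_cases hi : i = j
    · subst hi; exact hjm
    · exact hne i hi
  have : D.rank ≤ R.card := by
    rw [Matrix.rank_eq_finrank_span_row]
    exact (Submodule.finrank_mono hle).trans
      ((finrank_span_finset_le_card _).trans Finset.card_image_le)
  omega

lemma fiber_le {F : Type*} [Field F] [Fintype F] [DecidableEq F] {m n k : ℕ}
    (hk : 0 < k) (hkm : k ≤ m) (S : Finset (Matrix (Fin m) (Fin n) F))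
    (hS : ∀ X ∈ S, ∀ Y ∈ S, X ≠ Y → m - k + 1 ≤ (X - Y).rank)
    (u : Fin m → F) (hu : u ≠ 0) (v : Fin n → F) :
    (S.filter fun A => u ᵥ* A = v).card ≤ Fintype.card F ^ ((k - 1) * n) := by
  classical
  obtain ⟨j, hj⟩ := Function.ne_iff.1 hu
  obtain ⟨T, hT1, hT2⟩ := Finset.exists_subset_card_eq
    (s := Finset.univ.erase j) (n := k - 1) (by simp; omega)
  have hjT : j ∉ T := fun h => by simpa using hT1 h
  have hc : Fintype.card (T → Fin n → F) = Fintype.card F ^ ((k - 1) * n) := by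
    simp [hT2, ← pow_mul, mul_comm]
  rw [← hc, ← Finset.card_univ]
  refine Finset.card_le_card_of_injOn (fun A (i : T) => A i) (by simp) ?_
  intro A hA B hB hAB
  simp only [Finset.coe_filter, Set.mem_ofPred_eq] at hA hB
  by_contra hne
  have h1 := hS A hA.1 B hB.1 hne
  have h2 := rank_bound u j hj T hjT (A - B) (by rw [Matrix.vecMul_sub, hA.2, hB.2, sub_self])
    (fun i hi => by
      have := congrFun hAB ⟨i, hi⟩
      ext x
      have := congrFun this x
      simpa [sub_eq_zero] using this)
  omega

lemma fiber_eq {F : Type*} [Field F] [Fintype F] [DecidableEq F] {m n k : ℕ}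
    (hk : 0 < k) (hkm : k ≤ m) (S : Finset (Matrix (Fin m) (Fin n) F))
    (hc : S.card = Fintype.card F ^ (k * n))
    (hS : ∀ X ∈ S, ∀ Y ∈ S, X ≠ Y → m - k + 1 ≤ (X - Y).rank)
    (u : Fin m → F) (hu : u ≠ 0) (v : Fin n → F) :
    (S.filter fun A => u ᵥ* A = v).card = Fintype.card F ^ ((k - 1) * n) := by
  have h1 := Finset.card_eq_sum_card_fiberwise (s := S) (t := Finset.univ)
    (f := fun A => u ᵥ* A) (by intro x _; simp)
  have h2 : ∑ _v : Fin n → F, Fintype.card F ^ ((k - 1) * n) = S.card := by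
    rw [hc, Finset.sum_const, Finset.card_univ]
    obtain ⟨l, rfl⟩ := Nat.exists_eq_add_of_lt hk
    simp only [Fintype.card_fun, Fintype.card_fin, smul_eq_mul, ← pow_add]
    congr 1
    simp; ring
  have h3 := (Finset.sum_eq_sum_iff_of_le (s := Finset.univ)
    (fun v _ => fiber_le hk hkm S hS u hu v)).1 (by rw [h2]; exact h1.symm)
  exact h3 v (Finset.mem_univ v)

lemma hyper_card {F : Type*} [Field F] [Fintype F] [DecidableEq F] {m : ℕ}
    (u : Fin m → F) (hu : u ≠ 0) (c : F) :
    Fintype.card F * (Finset.univ.filter fun w : Fin m → F => u ⬝ᵥ w = c).card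
      = Fintype.card F ^ m := by
  obtain ⟨j, hj⟩ := Function.ne_iff.1 hu
  have hsurj : ∀ c : F, ∃ w : Fin m → F, u ⬝ᵥ w = c := fun c =>
    ⟨Pi.single j ((u j)⁻¹ * c), by
      have : u j ≠ 0 := hj
      simp [dotProduct_single, this]⟩
  have key : ∀ d : F, (Finset.univ.filter fun w : Fin m → F => u ⬝ᵥ w = d).card
      = (Finset.univ.filter fun w : Fin m → F => u ⬝ᵥ w = c).card := by
    intro d
    obtain ⟨w0, hw0⟩ := hsurj (c - d)
    refine Finset.card_bij' (fun w _ => w + w0) (fun w _ => w - w0) ?_ ?_ ?_ ?_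
    · intro w hw; simp at hw; simp [dotProduct_add, hw, hw0]
    · intro w hw; simp at hw; simp [dotProduct_sub, hw, hw0]
    · intro w _; simp
    · intro w _; simp
  have h1 := Finset.card_eq_sum_card_fiberwise (s := (Finset.univ : Finset (Fin m → F)))
    (t := Finset.univ) (f := fun w => u ⬝ᵥ w) (by intro x _; simp)
  rw [Finset.sum_congr rfl (fun d _ => key d)] at h1
  simpa using h1.symm

lemma dual_count {F : Type*} [Field F] [Fintype F] [DecidableEq F] {m n C : ℕ}
    (S : Finset (Matrix (Fin m) (Fin n) F))
    (hC : Fintype.card F ^ m * C = S.card)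
    (H : ∀ y : Fin n → F, y ≠ 0 → ∀ w, (S.filter fun A => A *ᵥ y = w).card = C)
    (u : Fin m → F) (hu : u ≠ 0) (v : Fin n → F) :
    (S.filter fun A => u ᵥ* A = v).card * Fintype.card F ^ n = S.card := by
  classical
  set q := Fintype.card F with hq
  have hq1 : 1 < q := Fintype.one_lt_card
  -- count pairs
  have hdc : ∑ y : Fin n → F, (S.filter fun A => (u ᵥ* A) ⬝ᵥ y = v ⬝ᵥ y).card
      = ∑ A ∈ S, (Finset.univ.filter fun y : Fin n → F => (u ᵥ* A) ⬝ᵥ y = v ⬝ᵥ y).card := by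
    simp only [Finset.card_filter]
    exact Finset.sum_comm
  have hA : ∀ A ∈ S, q * (Finset.univ.filter fun y : Fin n → F =>
      (u ᵥ* A) ⬝ᵥ y = v ⬝ᵥ y).card = if u ᵥ* A = v then q * q ^ n else q ^ n := by
    intro A _
    split_ifs with h
    · simp [h, hq]
    · rw [← hyper_card (u ᵥ* A - v) (sub_ne_zero.2 h) 0]
      simp [sub_dotProduct, sub_eq_zero, hq]
  have hy : ∀ y : Fin n → F, y ≠ 0 →
      q * (S.filter fun A => (u ᵥ* A) ⬝ᵥ y = v ⬝ᵥ y).card = S.card := by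
    intro y hy0
    have h1 := Finset.card_eq_sum_card_fiberwise
      (s := S.filter fun A => (u ᵥ* A) ⬝ᵥ y = v ⬝ᵥ y)
      (t := Finset.univ.filter fun w : Fin m → F => u ⬝ᵥ w = v ⬝ᵥ y)
      (f := fun A => A *ᵥ y) (by
        intro A hA
        simp only [Finset.coe_filter, Set.mem_ofPred_eq] at hA
        simp [dotProduct_mulVec, hA.2])
    have h2 : ∀ w ∈ Finset.univ.filter (fun w : Fin m → F => u ⬝ᵥ w = v ⬝ᵥ y),
        ((S.filter fun A => (u ᵥ* A) ⬝ᵥ y = v ⬝ᵥ y).filter fun A => A *ᵥ y = w).card = C := by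
      intro w hw
      rw [← H y hy0 w, Finset.filter_filter]
      congr 1
      apply Finset.filter_congr
      intro A _
      simp only [Finset.mem_filter, Finset.mem_univ, true_and] at hw
      constructor
      · exact fun h => h.2
      · intro h
        exact ⟨by rw [← dotProduct_mulVec, h, hw], h⟩
    rw [h1, Finset.sum_congr rfl h2, Finset.sum_const, smul_eq_mul, ← mul_assoc,
      hyper_card u hu, hC]
  have hL : q * ∑ y : Fin n → F, (S.filter fun A => (u ᵥ* A) ⬝ᵥ y = v ⬝ᵥ y).card + S.card
      = q * S.card + q ^ n * S.card := by
    rw [Finset.mul_sum, ← Finset.add_sum_erase _ _ (Finset.mem_univ (0 : Fin n → F)),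
      Finset.sum_congr rfl (fun y hy' => hy y (Finset.ne_of_mem_erase hy')),
      Finset.sum_const, Finset.card_erase_of_mem (Finset.mem_univ _)]
    have : 0 < q ^ n := by positivity
    obtain ⟨t, ht⟩ := Nat.exists_eq_add_of_lt this
    simp [← hq, ht]
    ring
  rw [hdc, Finset.mul_sum, Finset.sum_congr rfl hA, Finset.sum_ite, Finset.sum_const,
    Finset.sum_const] at hL
  have hsplit := Finset.card_filter_add_card_filter_not (s := S) (fun A => u ᵥ* A = v)
  obtain ⟨t, ht⟩ := Nat.exists_eq_add_of_lt hq1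
  simp only [smul_eq_mul] at hL
  set g := (S.filter fun A => u ᵥ* A = v).card
  set b := (S.filter fun A => ¬ u ᵥ* A = v).card
  set N := S.card
  have hfin : (t + 1) * (g * q ^ n) = (t + 1) * N := by
    generalize q ^ n = Q at *
    rw [ht] at hL
    have : g * Q + b * Q = N * Q := by rw [← hsplit]; ring
    nlinarith
  exact Nat.eq_of_mul_eq_mul_left (by omega) hfin

lemma count_main {F : Type*} [Field F] [Fintype F] [DecidableEq F] {k m n : ℕ}
    (hk : 0 < k) (hkm : k ≤ m) (hkn : k ≤ n)
    (S : Finset (Matrix (Fin m) (Fin n) F))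
    (hc : S.card = Fintype.card F ^ (k * max m n))
    (hS : ∀ X ∈ S, ∀ Y ∈ S, X ≠ Y → min m n - k + 1 ≤ (X - Y).rank)
    (u : Fin m → F) (hu : u ≠ 0) (v : Fin n → F) :
    (S.filter fun A => u ᵥ* A = v).card = Fintype.card F ^ (k * max m n - n) := by
  classical
  have hq1 : 1 < Fintype.card F := Fintype.one_lt_card
  rcases le_total m n with h | h
  · rw [max_eq_right h] at *
    rw [min_eq_left h] at hS
    rw [fiber_eq hk hkm S hc hS u hu v, Nat.sub_mul, one_mul]
  · rw [max_eq_left h] at *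
    rw [min_eq_right h] at hS
    have hinj : Function.Injective (transpose : Matrix (Fin m) (Fin n) F → _) :=
      transpose_injective
    have H : ∀ y : Fin n → F, y ≠ 0 → ∀ w,
        (S.filter fun A => A *ᵥ y = w).card = Fintype.card F ^ ((k - 1) * m) := by
      intro y hy w
      rw [← fiber_eq hk hkn (S.image transpose)
        (by rw [Finset.card_image_of_injective _ hinj, hc]) ?_ y hy w]
      · rw [Finset.filter_image, Finset.card_image_of_injective _ hinj]
        simp [vecMul_transpose]
      · intro X hX Y hY hXY
        simp only [Finset.mem_image] at hX hY
        obtain ⟨X, hX, rfl⟩ := hX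
        obtain ⟨Y, hY, rfl⟩ := hY
        rw [← transpose_sub, rank_transpose]
        exact hS X hX Y hY (fun e => hXY (by rw [e]))
    have hkm' : n ≤ k * m := h.trans (Nat.le_mul_of_pos_left m hk)
    have := dual_count S (by
      rw [hc, ← pow_add]
      congr 1
      obtain ⟨l, rfl⟩ := Nat.exists_eq_add_of_lt hk
      simp; ring) H u hu v
    rw [hc, ← Nat.sub_add_cancel hkm', pow_add] at this
    simpa using Nat.eq_of_mul_eq_mul_right (by positivity) this

/-- The uniform distribution over an `(m,n,k)` MRD code is a good pmf; equivalently,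
for every nonzero `u ∈ F^m` and every `v ∈ F^n` the number of `A ∈ 𝒜` with
`u*A = v` equals `q^(k·max m n − n)`. -/
theorem stmt3 {F : Type*} [Field F] [Fintype F] [DecidableEq F] (q k m n : ℕ)
    (hq : Fintype.card F = q) (hk : 0 < k) (hkm : k ≤ m) (hkn : k ≤ n)
    (𝒜 : Set (Matrix (Fin m) (Fin n) F)) (h𝒜 : IsMRD q k 𝒜) :
    IsKGood q 1 (Set.indicator 𝒜 fun _ => ((𝒜.ncard : ℝ))⁻¹) ∧
      ∀ u : Fin m → F, u ≠ 0 → ∀ v : Fin n → F,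
        {A ∈ 𝒜 | u ᵥ* A = v}.ncard = q ^ (k * max m n - n) := by
  classical
  subst hq
  obtain ⟨hc, hd⟩ := h𝒜
  have hS : ∀ X ∈ 𝒜.toFinset, ∀ Y ∈ 𝒜.toFinset, X ≠ Y → min m n - k + 1 ≤ (X - Y).rank := by
    intro X hX Y hY hXY
    rw [← hd]
    exact Nat.sInf_le ⟨X, by simpa using hX, Y, by simpa using hY, hXY, rfl⟩
  have hc' : 𝒜.toFinset.card = Fintype.card F ^ (k * max m n) := by
    rw [← hc, Set.ncard_eq_toFinset_card']
  have main := count_main hk hkm hkn 𝒜.toFinset hc' hS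
  have hle : n ≤ k * max m n :=
    (le_max_right m n).trans (Nat.le_mul_of_pos_left _ hk)
  have hq0 : (Fintype.card F : ℝ) ≠ 0 := by
    exact_mod_cast Fintype.card_ne_zero
  refine ⟨?_, ?_⟩
  · intro M hM K
    have hu : M 0 ≠ 0 := by
      intro h0
      have : M = 0 := by
        ext i j
        rw [Subsingleton.elim i 0, h0]; rfl
      rw [this, rank_zero] at hM
      exact absurd hM (by norm_num)
    have hiff : ∀ A : Matrix (Fin m) (Fin n) F, M * A = K ↔ M 0 ᵥ* A = K 0 := by
      intro A
      rw [← mul_apply_eq_vecMul]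
      constructor
      · intro h; rw [h]
      · intro h; ext i j
        rw [Subsingleton.elim i 0, h]
    have h1 : ∑ A ∈ Finset.univ.filter (fun A : Matrix (Fin m) (Fin n) F => M * A = K),
        Set.indicator 𝒜 (fun _ => ((𝒜.ncard : ℝ))⁻¹) A
        = ((𝒜.toFinset.filter fun A => M 0 ᵥ* A = K 0).card : ℝ) * ((𝒜.ncard : ℝ))⁻¹ := by
      simp only [Set.indicator_apply]
      rw [← Finset.sum_filter, Finset.sum_const, nsmul_eq_mul]
      congr 3
      ext A
      simp [hiff, and_comm]
    rw [h1, main _ hu, hc]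
    obtain ⟨t, ht⟩ := Nat.exists_eq_add_of_le hle
    rw [ht]
    push_cast
    rw [Nat.add_sub_cancel_left, pow_add, one_mul]
    field_simp
  · intro u hu v
    rw [← main u hu v, Set.ncard_eq_toFinset_card']
    congr 1
    ext A
    simp
end

section
/- Let F be a finite field with q elements and m, n positive integers. (a) Every good pmf f on F^{m×n} satisfies |supp(f)| ≥ q^{max(m,n)}. (b) If a pmf f on F^{m×n} has |supp(f)| = q^{max(m,n)}, then f is good if and only if supp(f) is an (m,n,1) MRD code and f is the uniform distribution on supp(f). -/
open Matrix

section helpers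
variable {F : Type*} [Field F] [Fintype F] [DecidableEq F]

theorem card_dot {k : ℕ} (v : Fin k → F) (hv : v ≠ 0) (c : F) :
    ((Finset.univ.filter fun w : Fin k → F => w ⬝ᵥ v = c).card : ℝ) * (Fintype.card F : ℝ)
      = (Fintype.card F : ℝ) ^ k := by
  obtain ⟨i, hi⟩ : ∃ i, v i ≠ 0 := by
    by_contra h; push Not at h; exact hv (funext h)
  let φ : (Fin k → F) →+ F :=
    { toFun := fun w => w ⬝ᵥ v
      map_zero' := by simp
      map_add' := fun a b => by simp [add_dotProduct] }
  have hs : ∀ c : F, c ∈ Set.range φ := fun c =>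
    ⟨Pi.single i (c / v i), by simp [φ, single_dotProduct, hi]⟩
  have h1 : ∀ d : F, (Finset.univ.filter fun w : Fin k → F => w ⬝ᵥ v = d).card
      = (Finset.univ.filter fun w : Fin k → F => w ⬝ᵥ v = c).card := fun d =>
    AddMonoidHom.card_fiber_eq_of_mem_range φ (hs d) (hs c)
  have h2 := Finset.card_eq_sum_card_fiberwise (f := fun w : Fin k → F => w ⬝ᵥ v)
    (s := Finset.univ) (t := Finset.univ) (fun _ _ => by simp)
  rw [Finset.sum_congr rfl (fun d _ => h1 d)] at h2
  simp at h2
  have : ((Fintype.card F : ℝ)) ^ k = (Fintype.card F : ℝ) * ((Finset.univ.filter fun w : Fin k → F => w ⬝ᵥ v = c).card : ℝ) := by exact_mod_cast h2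
  rw [this]; ring

def Good' {m n : ℕ} (f : Matrix (Fin m) (Fin n) F → ℝ) : Prop :=
  ∀ u : Fin m → F, u ≠ 0 → ∀ w : Fin n → F,
    ∑ A ∈ Finset.univ.filter fun A : Matrix (Fin m) (Fin n) F => u ᵥ* A = w, f A
      = ((Fintype.card F : ℝ) ^ n)⁻¹

theorem good_iff {m n : ℕ} (f : Matrix (Fin m) (Fin n) F → ℝ) :
    IsKGood (Fintype.card F) 1 f ↔ Good' f := by
  have key : ∀ (M : Matrix (Fin 1) (Fin m) F), M.rank = 1 ↔ M 0 ≠ 0 := by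
    intro M
    constructor
    · intro h h0
      have : M = 0 := by ext i j; fin_cases i; simpa using congrFun h0 j
      simp [this] at h
    · intro h
      have h1 := M.rank_le_height
      have h2 : M.rank ≠ 0 := by
        intro h3
        rw [Matrix.rank_eq_finrank_span_row, Submodule.finrank_eq_zero,
          Submodule.span_eq_bot] at h3
        exact h (h3 _ ⟨0, rfl⟩)
      omega
  have key2 : ∀ (M : Matrix (Fin 1) (Fin m) F) (A : Matrix (Fin m) (Fin n) F)
      (K : Matrix (Fin 1) (Fin n) F), M * A = K ↔ M 0 ᵥ* A = K 0 := by
    intro M A K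
    constructor
    · rintro rfl; rfl
    · intro h; ext i j; fin_cases i; exact congrFun h j
  constructor
  · intro h u hu w
    have := h (Matrix.of fun _ => u) ((key _).2 hu) (Matrix.of fun _ => w)
    simp only [key2, one_mul] at this
    exact this
  · intro h M hM K
    have := h (M 0) ((key _).1 hM) (K 0)
    simp only [key2, one_mul]
    exact this

theorem good_transpose_s4 {m n : ℕ} (f : Matrix (Fin m) (Fin n) F → ℝ)
    (hf : ∑ A, f A = 1) (h : Good' f) : Good' (fun A : Matrix (Fin n) (Fin m) F => f Aᵀ) := by
  intro v hv w0
  set q : ℝ := (Fintype.card F : ℝ) with hq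
  have hq1 : 1 < q := by rw [hq]; exact_mod_cast Fintype.one_lt_card
  have hq0 : q ≠ 0 := by positivity
  have e1 : ∑ A ∈ Finset.univ.filter (fun A : Matrix (Fin n) (Fin m) F => v ᵥ* A = w0), f Aᵀ
      = ∑ A : Matrix (Fin m) (Fin n) F, if A *ᵥ v = w0 then f A else 0 := by
    rw [Finset.sum_filter]
    refine Fintype.sum_equiv (Matrix.transposeAddEquiv (Fin n) (Fin m) F).toEquiv _ _ ?_
    intro A
    simp [Matrix.mulVec_transpose]
  rw [e1]
  set P := ∑ A : Matrix (Fin m) (Fin n) F, if A *ᵥ v = w0 then f A else 0 with hP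
  have hu : ∀ u : Fin m → F, u ≠ 0 →
      (∑ A : Matrix (Fin m) (Fin n) F, if u ⬝ᵥ (A *ᵥ v) = u ⬝ᵥ w0 then f A else 0) = q⁻¹ := by
    intro u hu
    have : (∑ A : Matrix (Fin m) (Fin n) F, if u ⬝ᵥ (A *ᵥ v) = u ⬝ᵥ w0 then f A else 0)
        = ∑ w ∈ Finset.univ.filter (fun w : Fin n → F => w ⬝ᵥ v = u ⬝ᵥ w0),
          ∑ A : Matrix (Fin m) (Fin n) F, if u ᵥ* A = w then f A else 0 := by
      rw [Finset.sum_comm]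
      refine Finset.sum_congr rfl fun A _ => ?_
      rw [Finset.sum_ite_eq]
      simp [dotProduct_mulVec]
    rw [this]
    simp only [← Finset.sum_filter]
    rw [Finset.sum_congr rfl (fun w _ => h u hu w), Finset.sum_const, nsmul_eq_mul]
    have := card_dot v hv (u ⬝ᵥ w0)
    rw [← hq] at this ⊢
    field_simp
    linarith
  have hcount : ∀ A : Matrix (Fin m) (Fin n) F,
      (∑ u : Fin m → F, if u ⬝ᵥ (A *ᵥ v) = u ⬝ᵥ w0 then f A else 0)
        = q ^ m * q⁻¹ * f A + (q ^ m - q ^ m * q⁻¹) * (if A *ᵥ v = w0 then f A else 0) := by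
    intro A
    by_cases hA : A *ᵥ v = w0
    · simp [hA, hq]
      ring
    · have := card_dot (A *ᵥ v - w0) (sub_ne_zero.2 hA) 0
      simp only [dotProduct_sub, sub_eq_zero] at this
      rw [← Finset.sum_filter, Finset.sum_const, nsmul_eq_mul, if_neg hA, ← this, ← hq]
      field_simp
      ring
  have tot : (∑ u : Fin m → F, ∑ A : Matrix (Fin m) (Fin n) F,
      if u ⬝ᵥ (A *ᵥ v) = u ⬝ᵥ w0 then f A else 0) = 1 + (q ^ m - 1) * q⁻¹ := by
    rw [← Finset.add_sum_erase _ _ (Finset.mem_univ (0 : Fin m → F))]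
    rw [Finset.sum_congr rfl (fun u hu' => hu u (Finset.ne_of_mem_erase hu'))]
    have hc : (((Finset.univ : Finset (Fin m → F)).erase 0).card : ℝ) = q ^ m - 1 := by
      rw [Finset.card_erase_of_mem (Finset.mem_univ _), Nat.cast_sub]
      · simp [hq]
      · exact Finset.card_pos.2 ⟨0, Finset.mem_univ _⟩
    rw [Finset.sum_const, nsmul_eq_mul, hc]
    simp [hf]
  rw [Finset.sum_comm, Finset.sum_congr rfl (fun A _ => hcount A), Finset.sum_add_distrib,
    ← Finset.mul_sum, ← Finset.mul_sum, hf, ← hP] at tot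
  have hqm : q ^ m ≠ 0 := by positivity
  have : (q - 1) * (P * q ^ m - 1) = 0 := by
    field_simp at tot
    linarith
  rcases mul_eq_zero.1 this with h | h
  · linarith
  · field_simp
    linarith

theorem rank_iff {m n : ℕ} (X Y : Matrix (Fin m) (Fin n) F) :
    (X - Y).rank = m ↔ ∀ u : Fin m → F, u ≠ 0 → u ᵥ* X ≠ u ᵥ* Y := by
  have : (X - Y).rank = m ↔ LinearIndependent F (X - Y).row := by
    rw [linearIndependent_iff_card_eq_finrank_span, Matrix.rank_eq_finrank_span_row]
    simp only [Fintype.card_fin]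
    exact eq_comm
  rw [this, ← Matrix.vecMul_injective_iff]
  constructor
  · intro h u hu e
    apply hu
    apply h
    simp [Matrix.vecMul_sub, e]
  · intro h a b e
    by_contra hab
    refine h (a - b) (sub_ne_zero.2 hab) ?_
    have : (a - b) ᵥ* (X - Y) = 0 := by
      rw [Matrix.sub_vecMul]; exact sub_eq_zero.2 e
    rw [Matrix.vecMul_sub] at this
    exact sub_eq_zero.1 this

theorem core {m n : ℕ} (hm : 0 < m)
    (f : Matrix (Fin m) (Fin n) F → ℝ) (hf : IsPmf f) :
    (Good' f → Fintype.card F ^ n ≤ (Function.support f).ncard) ∧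
      ((Function.support f).ncard = Fintype.card F ^ n →
        (Good' f ↔ (∀ X ∈ Function.support f, ∀ Y ∈ Function.support f, X ≠ Y → (X - Y).rank = m) ∧
            ∀ A ∈ Function.support f, f A = ((Fintype.card F : ℝ) ^ n)⁻¹)) := by
  classical
  set S : Finset (Matrix (Fin m) (Fin n) F) := Finset.univ.filter (fun A => f A ≠ 0) with hS
  have hSS : Function.support f = ↑S := by ext; simp [hS]
  have hq0 : (0 : ℝ) < ((Fintype.card F : ℝ) ^ n)⁻¹ := by positivity
  have hcard : (Finset.univ : Finset (Fin n → F)).card = Fintype.card F ^ n := by simp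
  have hsurj : Good' f → ∀ u : Fin m → F, u ≠ 0 →
      Set.SurjOn (fun A : Matrix (Fin m) (Fin n) F => u ᵥ* A) S (Finset.univ : Finset (Fin n → F)) := by
    intro h u hu w _
    have h1 := h u hu w
    have h2 : ∑ A ∈ Finset.univ.filter fun A : Matrix (Fin m) (Fin n) F => u ᵥ* A = w, f A ≠ 0 := by
      rw [h1]; exact hq0.ne'
    obtain ⟨A, hA, hA'⟩ := Finset.exists_ne_zero_of_sum_ne_zero h2
    exact ⟨A, by simpa [hS] using hA', by simpa using hA⟩
  rw [hSS, Set.ncard_coe_finset]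
  let u₀ : Fin m → F := Pi.single ⟨0, hm⟩ 1
  have hu₀ : u₀ ≠ 0 := by
    intro h; have := congrFun h ⟨0, hm⟩; simp [u₀] at this
  -- given injectivity and surjectivity, the fibre sum is a single value
  have hsum : ∀ u : Fin m → F, Set.InjOn (fun A : Matrix (Fin m) (Fin n) F => u ᵥ* A) S →
      ∀ A ∈ S, ∑ B ∈ Finset.univ.filter (fun B : Matrix (Fin m) (Fin n) F => u ᵥ* B = u ᵥ* A), f B
        = f A := by
    intro u hinj A hA
    refine Finset.sum_eq_single_of_mem A (by simp) ?_
    intro B hB hBA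
    by_contra h0
    exact hBA (hinj (by simpa [hS] using h0) hA (by simpa using hB))
  refine ⟨fun h => ?_, fun hc => ⟨fun h => ?_, ?_⟩⟩
  · rw [← hcard]
    exact Finset.card_le_card_of_surjOn _ (hsurj h u₀ hu₀)
  · have hinj : ∀ u : Fin m → F, u ≠ 0 →
        Set.InjOn (fun A : Matrix (Fin m) (Fin n) F => u ᵥ* A) S := fun u hu =>
      Finset.injOn_of_surjOn_of_card_le _ (fun _ _ => by simp) (hsurj h u hu) (by rw [hc, hcard])
    refine ⟨fun X hX Y hY hXY => (rank_iff X Y).2 fun u hu e => hXY (hinj u hu hX hY e), ?_⟩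
    intro A hA
    rw [← hsum u₀ (hinj u₀ hu₀) A hA]
    exact h u₀ hu₀ _
  · rintro ⟨hr, hun⟩ u hu w
    have hinj : Set.InjOn (fun A : Matrix (Fin m) (Fin n) F => u ᵥ* A) S := by
      intro X hX Y hY e
      by_contra hXY
      exact (rank_iff X Y).1 (hr X hX Y hY hXY) u hu e
    have hs := Finset.surjOn_of_injOn_of_card_le (s := S)
      (t := (Finset.univ : Finset (Fin n → F)))
      (fun A : Matrix (Fin m) (Fin n) F => u ᵥ* A) (fun _ _ => by simp) hinj
      (by rw [hc, hcard])
    obtain ⟨A, hA, rfl⟩ := hs (Finset.mem_coe.2 (Finset.mem_univ w))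
    rw [← hun A hA]
    exact hsum u hinj A hA

theorem mrd_iff {m n : ℕ} (hm : 0 < m) (hn : 0 < n) (S : Set (Matrix (Fin m) (Fin n) F))
    (hc : S.ncard = Fintype.card F ^ max m n) :
    IsMRD (Fintype.card F) 1 S ↔ ∀ X ∈ S, ∀ Y ∈ S, X ≠ Y → (X - Y).rank = min m n := by
  have hmin : min m n - 1 + 1 = min m n := by omega
  unfold IsMRD rankDist
  rw [one_mul, hmin]
  have h2 : 1 < S.ncard := by
    rw [hc]; exact Nat.one_lt_pow (by omega) Fintype.one_lt_card
  obtain ⟨A, B, hA, hB, hAB⟩ := (Set.one_lt_ncard_iff (Set.toFinite S)).1 h2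
  constructor
  · rintro ⟨-, h⟩ X hX Y hY hXY
    apply le_antisymm
    · exact le_min (Matrix.rank_le_height _) (Matrix.rank_le_width _)
    · rw [← h]
      exact Nat.sInf_le ⟨X, hX, Y, hY, hXY, rfl⟩
  · intro h
    refine ⟨hc, ?_⟩
    have : {r : ℕ | ∃ X ∈ S, ∃ Y ∈ S, X ≠ Y ∧ (X - Y).rank = r} = {min m n} := by
      ext r
      constructor
      · rintro ⟨X, hX, Y, hY, hXY, rfl⟩
        exact h X hX Y hY hXY
      · rintro rfl
        exact ⟨A, hA, B, hB, hAB, h A hA B hB hAB⟩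
    rw [this, csInf_singleton]

end helpers

/-- (a) Every good pmf on `F^{m×n}` has support of size at least `q^(max m n)`.
(b) A pmf with support of size exactly `q^(max m n)` is good iff its support is an
`(m,n,1)` MRD code and the pmf is uniform on its support. -/
theorem stmt4 {F : Type*} [Field F] [Fintype F] [DecidableEq F] (q m n : ℕ)
    (hq : Fintype.card F = q) (hm : 0 < m) (hn : 0 < n)
    (f : Matrix (Fin m) (Fin n) F → ℝ) (hf : IsPmf f) :
    (IsKGood q 1 f → q ^ max m n ≤ (Function.support f).ncard) ∧
      ((Function.support f).ncard = q ^ max m n →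
        (IsKGood q 1 f ↔
          IsMRD q 1 (Function.support f) ∧
            ∀ A ∈ Function.support f, f A = ((q : ℝ) ^ max m n)⁻¹)) := by
  subst hq
  rw [good_iff]
  suffices h : (Good' f → Fintype.card F ^ max m n ≤ (Function.support f).ncard) ∧
      ((Function.support f).ncard = Fintype.card F ^ max m n →
        (Good' f ↔ (∀ X ∈ Function.support f, ∀ Y ∈ Function.support f,
            X ≠ Y → (X - Y).rank = min m n) ∧
            ∀ A ∈ Function.support f, f A = ((Fintype.card F : ℝ) ^ max m n)⁻¹)) by
    refine ⟨h.1, fun hc => ?_⟩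
    rw [mrd_iff hm hn _ hc]
    exact h.2 hc
  rcases le_total m n with hmn | hmn
  · rw [max_eq_right hmn, min_eq_left hmn]
    exact core hm f hf
  · rw [max_eq_left hmn, min_eq_right hmn]
    set g : Matrix (Fin n) (Fin m) F → ℝ := fun A => f Aᵀ with hg
    have hgs : ∑ A, g A = 1 := by
      rw [← hf.2]
      exact Fintype.sum_equiv (Matrix.transposeAddEquiv (Fin n) (Fin m) F).toEquiv _ _
        (fun A => by simp [hg])
    have hgood : Good' f ↔ Good' g :=
      ⟨good_transpose_s4 f hf.2, fun h => by simpa [hg] using good_transpose_s4 g hgs h⟩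
    have hsupp : Function.support g
        = (Matrix.transposeAddEquiv (Fin m) (Fin n) F).toEquiv '' Function.support f := by
      rw [Equiv.image_eq_preimage_symm]
      ext A; simp [hg, Matrix.transposeAddEquiv]
    have hcd : (Function.support g).ncard = (Function.support f).ncard := by
      rw [hsupp]
      exact Set.ncard_image_of_injective _ (Equiv.injective _)
    have hmem : ∀ A, Aᵀ ∈ Function.support g ↔ A ∈ Function.support f := by
      intro A; simp [hg]
    have hmem' : ∀ A, A ∈ Function.support g ↔ Aᵀ ∈ Function.support f := by
      intro A; simp [hg]
    have c := core hn g ⟨fun A => hf.1 _, hgs⟩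
    rw [← hgood, hcd] at c
    refine ⟨c.1, fun hc => (c.2 hc).trans (and_congr ?_ ?_)⟩
    · constructor
      · intro h X hX Y hY hXY
        rw [← Matrix.rank_transpose, Matrix.transpose_sub]
        exact h _ ((hmem X).2 hX) _ ((hmem Y).2 hY) (fun e => hXY (Matrix.transpose_injective e))
      · intro h X hX Y hY hXY
        rw [← Matrix.rank_transpose, Matrix.transpose_sub]
        exact h _ ((hmem' X).1 hX) _ ((hmem' Y).1 hY) (fun e => hXY (Matrix.transpose_injective e))
    · constructor
      · intro h A hA
        simpa [hg] using h Aᵀ ((hmem A).2 hA)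
      · intro h A hA
        exact h Aᵀ ((hmem' A).1 hA)
end

section
/- Let F be a finite field with q elements and m, n positive integers. Let f be a good pmf on F^{m×n}, and let g be a pmf on the product space F^{m×m} × F^{n×n} × F^{m×n} such that g(P,Q,B) = 0 whenever P is not invertible or Q is not invertible. Then the pmf h on F^{m×n} defined by h(C) = ∑_{(A,P,Q,B) : P*A*Q + B = C} f(A)·g(P,Q,B) is good. (This models P̃ Ã Q̃ + B̃ where Ã has distribution f, is independent of (P̃,Q̃,B̃), and P̃, Q̃ are random invertible matrices.) -/
open Matrix

/-- If `Ã` is a good random `m×n` matrix independent of `(P̃, Q̃, B̃)`, where `P̃` and `Q̃`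
are random invertible matrices, then `P̃ Ã Q̃ + B̃` is good. -/
theorem stmt5 {F : Type*} [Field F] [Fintype F] [DecidableEq F] (q m n : ℕ)
    (hq : Fintype.card F = q) (hm : 0 < m) (hn : 0 < n)
    (f : Matrix (Fin m) (Fin n) F → ℝ) (hf : IsPmf f) (hfg : IsKGood q 1 f)
    (g : Matrix (Fin m) (Fin m) F × Matrix (Fin n) (Fin n) F × Matrix (Fin m) (Fin n) F → ℝ)
    (hg : IsPmf g)
    (hginv : ∀ P Q B, ¬IsUnit P ∨ ¬IsUnit Q → g (P, Q, B) = 0) :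
    IsKGood q 1 (fun C : Matrix (Fin m) (Fin n) F =>
      ∑ A : Matrix (Fin m) (Fin n) F, ∑ P : Matrix (Fin m) (Fin m) F,
        ∑ Q : Matrix (Fin n) (Fin n) F, ∑ B : Matrix (Fin m) (Fin n) F,
          if P * A * Q + B = C then f A * g (P, Q, B) else 0) := by
  intro M hM K
  have key : ∀ x : Matrix (Fin m) (Fin m) F × Matrix (Fin n) (Fin n) F × Matrix (Fin m) (Fin n) F,
      (∑ A : Matrix (Fin m) (Fin n) F,
        if M * (x.1 * A * x.2.1 + x.2.2) = K then f A * g x else 0)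
        = g x * ((q : ℝ) ^ (1 * n))⁻¹ := by
    rintro ⟨P, Q, B⟩
    by_cases h : IsUnit P ∧ IsUnit Q
    · obtain ⟨hP, hQ⟩ := h
      have hP' := (Matrix.isUnit_iff_isUnit_det P).1 hP
      have hQ' := (Matrix.isUnit_iff_isUnit_det Q).1 hQ
      have hr : (M * P).rank = 1 := by
        rw [Matrix.rank_mul_eq_left_of_isUnit_det P M hP', hM]
      rw [← hfg (M * P) hr ((K - M * B) * Q⁻¹), Finset.sum_filter, Finset.mul_sum]
      refine Finset.sum_congr rfl fun A _ => ?_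
      have e : M * (P * A * Q + B) = K ↔ M * P * A = (K - M * B) * Q⁻¹ := by
        constructor
        · intro h
          rw [← h, Matrix.mul_add, add_sub_cancel_right]
          simp only [← Matrix.mul_assoc]
          rw [Matrix.mul_nonsing_inv_cancel_right _ _ hQ']
        · intro h
          have : M * (P * A * Q + B) = M * P * A * Q + M * B := by
            rw [Matrix.mul_add]
            simp only [← Matrix.mul_assoc]
          rw [this, h, Matrix.nonsing_inv_mul_cancel_right _ _ hQ', sub_add_cancel]
      simp only [e]
      split_ifs <;> ring
    · have h0 : g (P, Q, B) = 0 := hginv P Q B (by tauto)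
      simp [h0]
  have h1 := Finset.sum_congr (rfl : (Finset.univ : Finset (Matrix (Fin m) (Fin m) F ×
    Matrix (Fin n) (Fin n) F × Matrix (Fin m) (Fin n) F)) = Finset.univ) fun x _ => key x
  rw [← Finset.sum_mul, hg.2, one_mul, Finset.sum_comm] at h1
  rw [← h1, Finset.sum_comm]
  refine Finset.sum_congr rfl fun A _ => ?_
  rw [Fintype.sum_prod_type, Finset.sum_comm]
  refine Finset.sum_congr rfl fun P _ => ?_
  rw [Fintype.sum_prod_type, Finset.sum_comm]
  refine Finset.sum_congr rfl fun Q _ => ?_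
  rw [Finset.sum_comm]
  refine Finset.sum_congr rfl fun B _ => ?_
  rw [Finset.sum_ite_eq]
  simp
end

section
/- Let F be a finite field with q elements and k, m, n positive integers with k ≤ min(m,n). A pmf f on F^{m×n} is k-good if and only if the transposed pmf fᵀ on F^{n×m}, defined by fᵀ(B) = f(Bᵀ), is k-good. -/
open Matrix

theorem aux_extend {F : Type*} [Field F] {m : ℕ} (W : Submodule F (Fin m → F)) (d : ℕ)
    (hd : Module.finrank F W ≤ d) (hm : d ≤ m) :
    ∃ v : Fin d → Fin m → F, LinearIndependent F v ∧ W ≤ Submodule.span F (Set.range v) := by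
  induction d, hd using Nat.le_induction with
  | base =>
    let b := Module.finBasis F W
    refine ⟨fun i => (b i : Fin m → F), ?_, ?_⟩
    · exact b.linearIndependent.map' W.subtype (Submodule.ker_subtype W)
    · intro x hx
      have h := b.mem_span (⟨x, hx⟩ : W)
      have h2 := Submodule.mem_map_of_mem (f := W.subtype) h
      rw [Submodule.map_span, ← Set.range_comp] at h2
      exact h2
  | succ d hd ih =>
    obtain ⟨v, hv, hW⟩ := ih (by omega)
    obtain ⟨x, hx⟩ := exists_linearIndependent_snoc_of_lt_finrank hv (by simp; omega)
    refine ⟨_, hx, hW.trans (Submodule.span_mono ?_)⟩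
    rintro _ ⟨i, rfl⟩
    exact ⟨i.castSucc, by simp⟩

theorem aux_factor {F : Type*} [Field F] {k m : ℕ} (hkm : k ≤ m)
    (X : Matrix (Fin k) (Fin m) F) :
    ∃ (P : Matrix (Fin k) (Fin k) F) (M : Matrix (Fin k) (Fin m) F), M.rank = k ∧ X = P * M := by
  obtain ⟨v, hv, hW⟩ := aux_extend (Submodule.span F (Set.range X.row)) k
    (by simpa [Set.finrank] using finrank_range_le_card (R := F) X.row) hkm
  have h : ∀ i, ∃ c : Fin k → F, ∑ j, c j • v j = X i := fun i =>
    (Submodule.mem_span_range_iff_exists_fun F).1 (hW (Submodule.subset_span ⟨i, rfl⟩))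
  choose P hP using h
  refine ⟨Matrix.of P, Matrix.of v, ?_, ?_⟩
  · simpa using LinearIndependent.rank_matrix (M := Matrix.of v) hv
  · ext i j
    rw [← hP i]
    simp [Matrix.mul_apply]

theorem aux_inj {F : Type*} [Field F] {k m n : ℕ} {M : Matrix (Fin k) (Fin m) F}
    (hM : M.rank = k) {L : Matrix (Fin n) (Fin k) F} (h : L * M = 0) : L = 0 := by
  have hl : LinearIndependent F M.row := by
    rw [linearIndependent_iff_card_eq_finrank_span, Set.finrank, ← Matrix.rank_eq_finrank_span_row,
      hM, Fintype.card_fin]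
  have hi := Matrix.vecMul_injective_iff.2 hl
  ext i j
  have : L i ᵥ* M = 0 ᵥ* M := by
    rw [Matrix.zero_vecMul]
    exact congrFun h i
  exact congrFun (hi this) j

theorem aux_sum {F : Type*} [Field F] [Fintype F] [DecidableEq F] {a b : ℕ}
    (ψ : AddChar F ℂ) (hψ : ψ ≠ 1) (Z : Matrix (Fin b) (Fin a) F) :
    ∑ L : Matrix (Fin a) (Fin b) F, ψ (trace (L * Z)) =
      if Z = 0 then ((Fintype.card F : ℂ) ^ (a * b)) else 0 := by
  split_ifs with hZ
  · subst hZ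
    have hc : Fintype.card (Matrix (Fin a) (Fin b) F) = Fintype.card F ^ (a * b) := by
      rw [← Nat.card_eq_fintype_card, ← Nat.card_eq_fintype_card]
      change Nat.card (Fin a → Fin b → F) = _
      simp [Nat.card_fun, ← pow_mul, mul_comm]
    simp [hc]
  · let χ : AddChar (Matrix (Fin a) (Fin b) F) ℂ :=
      { toFun := fun L => ψ (trace (L * Z))
        map_zero_eq_one' := by simp
        map_add_eq_mul' := by
          intro x y
          simp [Matrix.add_mul, AddChar.map_add_eq_mul] }
    refine AddChar.sum_eq_zero_of_ne_one (ψ := χ) ?_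
    intro h
    obtain ⟨i, j, hij⟩ : ∃ i j, Z i j ≠ 0 := by
      by_contra! hc
      exact hZ (by ext i j; simpa using hc i j)
    obtain ⟨x, hx⟩ := AddChar.ne_one_iff.1 hψ
    apply hx
    have := DFunLike.congr_fun h (Matrix.single j i (x / Z i j))
    simpa [χ, Matrix.trace_single_mul, hij] using this

theorem aux_fourier {F : Type*} [Field F] [Fintype F] [DecidableEq F] {k m n : ℕ}
    (ψ : AddChar F ℂ) (hψ : ψ ≠ 1) (f : Matrix (Fin m) (Fin n) F → ℝ)
    (h : IsKGood (Fintype.card F) k f) (M : Matrix (Fin k) (Fin m) F) (hM : M.rank = k)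
    (L : Matrix (Fin n) (Fin k) F) (hL : L ≠ 0) :
    ∑ A, (f A : ℂ) * ψ (trace (L * (M * A))) = 0 := by
  rw [← Finset.sum_fiberwise (s := Finset.univ) (g := fun A => M * A)]
  have : ∀ K : Matrix (Fin k) (Fin n) F,
      ∑ A ∈ Finset.univ.filter (fun A => M * A = K), (f A : ℂ) * ψ (trace (L * (M * A)))
      = (((Fintype.card F : ℝ) ^ (k * n))⁻¹ : ℝ) * ψ (trace (K * L)) := by
    intro K
    rw [← h M hM K, Complex.ofReal_sum, Finset.sum_mul]
    refine Finset.sum_congr rfl fun A hA => ?_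
    rw [(Finset.mem_filter.1 hA).2, Matrix.trace_mul_comm]
  rw [Finset.sum_congr rfl fun K _ => this K, ← Finset.mul_sum, aux_sum ψ hψ, if_neg hL, mul_zero]

theorem aux_dir {F : Type*} [Field F] [Fintype F] [DecidableEq F] {k m n : ℕ}
    (hkm : k ≤ m)
    (f : Matrix (Fin m) (Fin n) F → ℝ) (hf : IsPmf f) (h : IsKGood (Fintype.card F) k f) :
    IsKGood (Fintype.card F) k (fun B : Matrix (Fin n) (Fin m) F => f B.transpose) := by
  obtain ⟨ψ, hψ⟩ : ∃ ψ : AddChar F ℂ, ψ ≠ 1 := by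
    refine ⟨AddChar.FiniteField.primitiveChar_to_Complex F, ?_⟩
    have := AddChar.FiniteField.primitiveChar_to_Complex_isPrimitive F (one_ne_zero)
    rwa [AddChar.mulShift_one] at this
  intro N hN K
  have hq : (Fintype.card F : ℂ) ≠ 0 := Nat.cast_ne_zero.2 Fintype.card_ne_zero
  have key : ∀ L : Matrix (Fin m) (Fin k) F,
      ∑ B : Matrix (Fin n) (Fin m) F, (f Bᵀ : ℂ) * ψ (trace (L * (N * B))) =
        if L = 0 then 1 else 0 := by
    intro L
    split_ifs with hL
    · subst hL
      have := hf.2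
      rw [← Equiv.sum_comp (Matrix.transposeAddEquiv (Fin n) (Fin m) F).toEquiv] at this
      simp only [Matrix.zero_mul, Matrix.trace_zero, AddChar.map_zero_eq_one, mul_one]
      exact_mod_cast this
    · obtain ⟨P, M, hM, hX⟩ := aux_factor hkm Lᵀ
      have hne : Nᵀ * P ≠ 0 := by
        intro h0
        have : L * N = 0 := by
          have h1 : Nᵀ * Lᵀ = 0 := by rw [hX, ← Matrix.mul_assoc, h0, Matrix.zero_mul]
          rw [← Matrix.transpose_mul] at h1
          exact Matrix.transpose_eq_zero.1 h1
        exact hL (aux_inj hN this)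
      have := aux_fourier ψ hψ f h M hM (Nᵀ * P) hne
      rw [← Equiv.sum_comp (Matrix.transposeAddEquiv (Fin n) (Fin m) F).toEquiv] at this
      rw [← this]
      refine Finset.sum_congr rfl fun B _ => ?_
      change _ = (f Bᵀ : ℂ) * ψ (trace (Nᵀ * P * (M * Bᵀ)))
      congr 2
      have e : Nᵀ * P * (M * Bᵀ) = (B * L * N)ᵀ := by
        rw [Matrix.transpose_mul, Matrix.transpose_mul, hX]
        simp only [Matrix.mul_assoc]
      rw [e, Matrix.trace_transpose, Matrix.mul_assoc B, Matrix.trace_mul_comm B,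
        Matrix.mul_assoc]
  have main : ((Fintype.card F : ℂ) ^ (m * k)) *
      ∑ B ∈ Finset.univ.filter (fun B : Matrix (Fin n) (Fin m) F => N * B = K), (f Bᵀ : ℂ) = 1 := by
    calc _ = ∑ B : Matrix (Fin n) (Fin m) F, (f Bᵀ : ℂ) *
          ∑ L : Matrix (Fin m) (Fin k) F, ψ (trace (L * (N * B - K))) := by
          rw [Finset.sum_filter, Finset.mul_sum]
          refine Finset.sum_congr rfl fun B _ => ?_
          rw [aux_sum ψ hψ]
          simp only [sub_eq_zero]
          split_ifs <;> ring
      _ = ∑ L : Matrix (Fin m) (Fin k) F, ψ (-trace (L * K)) *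
          ∑ B : Matrix (Fin n) (Fin m) F, (f Bᵀ : ℂ) * ψ (trace (L * (N * B))) := by
          simp only [Finset.mul_sum]
          rw [Finset.sum_comm]
          refine Finset.sum_congr rfl fun L _ => Finset.sum_congr rfl fun B _ => ?_
          rw [Matrix.mul_sub, Matrix.trace_sub, sub_eq_add_neg, AddChar.map_add_eq_mul]
          ring
      _ = 1 := by simp [key]
  have main' : ((Fintype.card F : ℝ) ^ (k * m)) *
      ∑ B ∈ Finset.univ.filter (fun B : Matrix (Fin n) (Fin m) F => N * B = K), f Bᵀ = 1 := by
    rw [mul_comm k m]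
    exact_mod_cast main
  exact eq_inv_of_mul_eq_one_right main'

/-- A pmf on `F^{m×n}` is `k`-good iff its transpose is `k`-good. -/
theorem stmt6 {F : Type*} [Field F] [Fintype F] [DecidableEq F] (q k m n : ℕ)
    (hq : Fintype.card F = q) (hk : 0 < k) (hkm : k ≤ m) (hkn : k ≤ n)
    (f : Matrix (Fin m) (Fin n) F → ℝ) (hf : IsPmf f) :
    IsKGood q k f ↔ IsKGood q k (fun B : Matrix (Fin n) (Fin m) F => f B.transpose) := by
  subst hq
  refine ⟨aux_dir hkm f hf, fun h => ?_⟩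
  have hf' : IsPmf (fun B : Matrix (Fin n) (Fin m) F => f B.transpose) := by
    refine ⟨fun B => hf.1 _, ?_⟩
    have := hf.2
    rwa [← Equiv.sum_comp (Matrix.transposeAddEquiv (Fin n) (Fin m) F).toEquiv] at this
  exact aux_dir hkn _ hf' h
end

section
/- Let F be a finite field with q elements and k, l, m, n positive integers with k ≤ l ≤ m ≤ n and k + n ≥ l + m. Let N ∈ F^{m×n} be a matrix of rank l. Then the number of matrices M ∈ F^{m×n} with rank(M) = m and rank(M·Nᵀ) = k equals q^{k(n−l−m+k)} · G_q(l,k) · G_q(n−l, m−k) · ∏_{i=0}^{m−1} (q^m − q^i). -/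
open Module in
theorem card_fib {α β : Type*} [Finite α] [Finite β] (φ : α → β) (c : ℕ)
    (h : ∀ b, Nat.card {a // φ a = b} = c) : Nat.card α = Nat.card β * c := by
  classical
  have := Fintype.ofFinite β
  rw [Nat.card_congr (Equiv.sigmaFiberEquiv φ).symm, Nat.card_sigma]
  simp [h]

section
variable {F D E V : Type*} [Field F] [AddCommGroup D] [Module F D] [AddCommGroup E] [Module F E]
  [AddCommGroup V] [Module F V]

/-- Subspaces with prescribed projection and prescribed kernel part. -/
theorem card_sub (U : Submodule F D) (A : Submodule F E) :
    Nat.card {W : Submodule F (D × E) //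
      W.map (LinearMap.fst F D E) = U ∧ W.comap (LinearMap.inr F D E) = A}
      = Nat.card (U →ₗ[F] (E ⧸ A)) := by
  symm
  let π : D × E →ₗ[F] D × (E ⧸ A) := LinearMap.prodMap LinearMap.id A.mkQ
  have hπ : Function.Surjective π := by
    rintro ⟨d, e⟩
    obtain ⟨e, rfl⟩ := A.mkQ_surjective e
    exact ⟨(d, e), rfl⟩
  have hmem : ∀ (g : U →ₗ[F] (E ⧸ A)) (d : D) (e : E),
      (d, e) ∈ (LinearPMap.graph ⟨U, g⟩).comap π ↔ ∃ h : d ∈ U, g ⟨d, h⟩ = A.mkQ e := by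
    intro g d e
    rw [Submodule.mem_comap, LinearPMap.mem_graph_iff]
    constructor
    · rintro ⟨y, h1, h2⟩
      have h1' : (y : D) = d := h1
      subst h1'
      exact ⟨y.2, h2⟩
    · rintro ⟨h, h2⟩
      exact ⟨⟨d, h⟩, rfl, h2⟩
  refine Nat.card_congr (Equiv.ofBijective
    (fun g => ⟨(LinearPMap.graph ⟨U, g⟩).comap π, ?_, ?_⟩) ⟨?_, ?_⟩)
  · ext d
    constructor
    · rintro ⟨⟨d, e⟩, h, rfl⟩
      exact ((hmem g d e).1 h).1
    · intro hd
      obtain ⟨e, he⟩ := A.mkQ_surjective (g ⟨d, hd⟩)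
      exact ⟨(d, e), (hmem g d e).2 ⟨hd, he.symm⟩, rfl⟩
  · ext e
    rw [Submodule.mem_comap, LinearMap.inr_apply, hmem]
    constructor
    · rintro ⟨h, h2⟩
      have : g ⟨0, h⟩ = 0 := g.map_zero
      rw [this] at h2
      simpa using h2.symm
    · intro he
      refine ⟨U.zero_mem, ?_⟩
      have : g ⟨0, U.zero_mem⟩ = 0 := g.map_zero
      rw [this]
      symm
      simpa using he
  · intro g g' h
    ext ⟨d, hd⟩
    obtain ⟨e, he⟩ := A.mkQ_surjective (g ⟨d, hd⟩)
    have h1 := (hmem g d e).2 ⟨hd, he.symm⟩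
    have h' := congrArg Subtype.val h
    simp only at h'
    rw [h'] at h1
    obtain ⟨_, h2⟩ := (hmem g' d e).1 h1
    rw [h2, he]
  · rintro ⟨W, hU, hA⟩
    subst hU
    have hker : LinearMap.ker π ≤ W := by
      rintro ⟨d, e⟩ h
      have h' : (d, A.mkQ e) = 0 := h
      have hd : d = 0 := congrArg Prod.fst h'
      have he : A.mkQ e = 0 := congrArg Prod.snd h'
      subst hd
      have : e ∈ A := by simpa using he
      rw [← hA] at this
      exact this
    have hg : ∀ x ∈ W.map π, x.1 = 0 → x.2 = 0 := by
      rintro _ ⟨⟨d, e⟩, h, rfl⟩ h0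
      have hd : d = 0 := h0
      subst hd
      have : e ∈ A := by rw [← hA]; exact h
      change A.mkQ e = 0
      simpa using this
    have hdom : (W.map π).map (LinearMap.fst F D (E ⧸ A)) = W.map (LinearMap.fst F D E) := by
      rw [← Submodule.map_comp]; rfl
    have hgr := Submodule.toLinearPMap_graph_eq (W.map π) hg
    have hd2 := Submodule.toLinearPMap_domain (W.map π)
    rw [hdom] at hd2
    generalize (W.map π).toLinearPMap = p at hgr hd2
    obtain ⟨pd, pf⟩ := p
    have hd2' : pd = W.map (LinearMap.fst F D E) := hd2
    subst hd2'
    refine ⟨pf, Subtype.ext ?_⟩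
    simp only
    rw [hgr, Submodule.comap_map_eq, sup_eq_left]
    exact hker

theorem finrank_split [FiniteDimensional F D] [FiniteDimensional F E] (W : Submodule F (D × E)) :
    Module.finrank F (W.map (LinearMap.fst F D E)) +
      Module.finrank F (W.comap (LinearMap.inr F D E)) = Module.finrank F W := by
  have h := LinearMap.finrank_range_add_finrank_ker ((LinearMap.fst F D E).domRestrict W)
  rw [← h]
  congr 1
  · rw [LinearMap.range_domRestrict]
  · refine LinearEquiv.finrank_eq (LinearEquiv.ofBijective
      ((((LinearMap.inr F D E).restrict (p := W.comap (LinearMap.inr F D E)) (q := W)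
        (fun x hx => hx))).codRestrict _ ?_) ⟨?_, ?_⟩)
    · intro x; rfl
    · rintro ⟨x, hx⟩ ⟨y, hy⟩ h
      have := congrArg (fun z => (z.1.1 : D × E).2) h
      exact Subtype.ext this
    · rintro ⟨⟨⟨d, e⟩, h⟩, h0⟩
      have hd : d = 0 := h0
      subst hd
      exact ⟨⟨e, h⟩, rfl⟩

theorem card_hom [Fintype F] [Finite D] [Finite E] :
    Nat.card (D →ₗ[F] E) = Fintype.card F ^ (Module.finrank F D * Module.finrank F E) := by
  have : Finite (D →ₗ[F] E) := Finite.of_injective _ DFunLike.coe_injective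
  have := Fintype.ofFinite (D →ₗ[F] E)
  rw [Nat.card_eq_fintype_card, Module.card_eq_pow_finrank (K := F), Module.finrank_linearMap]

theorem card_subs [Fintype F] [Finite D] [Finite E] (k m : ℕ) (hkm : k ≤ m) :
    Nat.card {W : Submodule F (D × E) // Module.finrank F W = m ∧
      Module.finrank F (W.map (LinearMap.fst F D E)) = k} =
    (Nat.card {U : Submodule F D // Module.finrank F U = k} *
      Nat.card {A : Submodule F E // Module.finrank F A = m - k}) *
      Fintype.card F ^ (k * (Module.finrank F E - (m - k))) := by
  rw [← Nat.card_prod]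
  refine card_fib (fun W => (⟨W.1.map (LinearMap.fst F D E), W.2.2⟩,
    ⟨W.1.comap (LinearMap.inr F D E), by
      have := finrank_split W.1
      have := W.2.1
      have := W.2.2
      omega⟩)) _ ?_
  · rintro ⟨⟨U, hU⟩, ⟨A, hA⟩⟩
    have h1 := card_sub U A
    have : Finite (E ⧸ A) := Finite.of_surjective _ A.mkQ_surjective
    rw [card_hom, hU, Submodule.finrank_quotient, hA] at h1
    rw [← h1]
    refine Nat.card_congr ⟨fun W => ⟨W.1.1, ?_, ?_⟩, fun W => ⟨⟨W.1, ?_, ?_⟩, ?_⟩,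
      fun _ => rfl, fun _ => rfl⟩
    · exact congrArg (fun z => z.1.1) W.2
    · exact congrArg (fun z => z.2.1) W.2
    · rw [← finrank_split W.1, W.2.1, W.2.2, hU, hA]; omega
    · rw [W.2.1, hU]
    · exact Prod.ext (Subtype.ext W.2.1) (Subtype.ext W.2.2)

theorem card_fam [Fintype F] [Finite V] (m : ℕ) (P : Submodule F V → Prop) :
    Nat.card {v : Fin m → V // LinearIndependent F v ∧ P (Submodule.span F (Set.range v))} =
    Nat.card {W : Submodule F V // Module.finrank F W = m ∧ P W} *
      ∏ i ∈ Finset.range m, (Fintype.card F ^ m - Fintype.card F ^ i) := by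
  refine card_fib (fun v => ⟨Submodule.span F (Set.range v.1),
    by rw [finrank_span_eq_card v.2.1, Fintype.card_fin], v.2.2⟩) _ ?_
  · rintro ⟨W, hW, hP⟩
    have h1 := card_linearIndependent (K := F) (V := W) (k := m) hW.ge
    rw [hW, Fin.prod_univ_eq_prod_range (fun i => Fintype.card F ^ m - Fintype.card F ^ i)] at h1
    rw [← h1]
    have key : ∀ s : Fin m → W, LinearIndependent F s →
        LinearIndependent F (fun i => (s i : V)) ∧
        Submodule.span F (Set.range (fun i => (s i : V))) = W := by
      intro s hs
      have hli : LinearIndependent F (fun i => (s i : V)) :=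
        hs.map' W.subtype (Submodule.ker_subtype W)
      refine ⟨hli, Submodule.eq_of_le_of_finrank_eq ?_ ?_⟩
      · rw [Submodule.span_le]
        rintro _ ⟨i, rfl⟩
        exact (s i).2
      · rw [finrank_span_eq_card hli, Fintype.card_fin, hW]
    refine Nat.card_congr ⟨fun v => ⟨fun i => ⟨v.1.1 i, ?_⟩, ?_⟩,
      fun s => ⟨⟨fun i => (s.1 i : V), (key s.1 s.2).1, ?_⟩, ?_⟩, fun _ => rfl, fun _ => rfl⟩
    · have := congrArg Subtype.val v.2
      simp only at this
      exact this.le (Submodule.subset_span ⟨i, rfl⟩)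
    · exact LinearIndependent.of_comp W.subtype v.1.2.1
    · rw [(key s.1 s.2).2]; exact hP
    · exact Subtype.ext (key s.1 s.2).2

theorem exists_split [FiniteDimensional F V] (g : V →ₗ[F] D) (l n : ℕ)
    (hn : Module.finrank F V = n) (hl : Module.finrank F (LinearMap.range g) = l) :
    ∃ (e : V ≃ₗ[F] (Fin l → F) × (Fin (n - l) → F)) (h : (Fin l → F) →ₗ[F] D),
      Function.Injective h ∧ ∀ x, g x = h (e x).1 := by
  obtain ⟨p, hp⟩ := LinearMap.exists_leftInverse_of_injective (LinearMap.ker g).subtype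
    (Submodule.ker_subtype _)
  have hp' : ∀ x : LinearMap.ker g, p x = x := fun x => LinearMap.congr_fun hp x
  let e0 := LinearMap.equivProdOfSurjectiveOfIsCompl g.rangeRestrict p
    (LinearMap.range_rangeRestrict g)
    (LinearMap.range_eq_top.2 fun x => ⟨x, hp' x⟩)
    (by
      rw [LinearMap.ker_rangeRestrict]
      exact LinearMap.isCompl_of_proj hp')
  have hk : Module.finrank F (LinearMap.ker g) = n - l := by
    have := LinearMap.finrank_range_add_finrank_ker g
    omega
  let e1 : LinearMap.range g ≃ₗ[F] (Fin l → F) := LinearEquiv.ofFinrankEq _ _ (by simp [hl])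
  let e2 : LinearMap.ker g ≃ₗ[F] (Fin (n - l) → F) := LinearEquiv.ofFinrankEq _ _ (by simp [hk])
  refine ⟨e0.trans (LinearEquiv.prodCongr e1 e2), (LinearMap.range g).subtype ∘ₗ e1.symm.toLinearMap,
    ?_, ?_⟩
  · exact (Subtype.val_injective).comp e1.symm.injective
  · intro x
    change g x = ((e1.symm (e1 (g.rangeRestrict x)) : LinearMap.range g) : D)
    simp

end


open Matrix

/-- The Gaussian binomial coefficient `G_q(a,b)`: the number of `b`-dimensional
`F`-linear subspaces of `F^a`, where `F` is a finite field with `q` elements. -/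
noncomputable def Gq (F : Type*) [Field F] [Fintype F] (a b : ℕ) : ℕ :=
  Nat.card {W : Submodule F (Fin a → F) // Module.finrank F W = b}

/-- Counting lemma: for `k ≤ l ≤ m ≤ n` with `k + n ≥ l + m` and `N ∈ F^{m×n}` of rank `l`,
the number of `M ∈ F^{m×n}` with `rank M = m` and `rank (M Nᵀ) = k` equals
`q^{k(n−l−m+k)} G_q(l,k) G_q(n−l, m−k) ∏_{i=0}^{m−1} (q^m − q^i)`. -/
theorem stmt7 {F : Type*} [Field F] [Fintype F] [DecidableEq F] (q k l m n : ℕ)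
    (hq : Fintype.card F = q) (hk : 0 < k) (hkl : k ≤ l) (hlm : l ≤ m) (hmn : m ≤ n)
    (hkn : l + m ≤ k + n)
    (N : Matrix (Fin m) (Fin n) F) (hN : N.rank = l) :
    {M : Matrix (Fin m) (Fin n) F | M.rank = m ∧ (M * N.transpose).rank = k}.ncard
      = q ^ (k * (n + k - l - m)) * Gq F l k * Gq F (n - l) (m - k) *
          ∏ i ∈ Finset.range m, (q ^ m - q ^ i) := by
  classical
  obtain ⟨e, h, hh, hg⟩ := exists_split N.mulVecLin l n (by simp) hN
  have hrow : ∀ M : Matrix (Fin m) (Fin n) F, M.rank = m ↔ LinearIndependent F (fun i => e (M i)) := by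
    intro M
    rw [Matrix.rank_eq_finrank_span_row]
    have : LinearIndependent F (fun i => e (M i)) ↔ LinearIndependent F M.row :=
      LinearMap.linearIndependent_iff e.toLinearMap e.ker
    rw [this, linearIndependent_iff_card_eq_finrank_span, Fintype.card_fin, eq_comm]
    rfl
  have hprod : ∀ M : Matrix (Fin m) (Fin n) F, (M * N.transpose).rank =
      Module.finrank F ((Submodule.span F (Set.range (fun i => e (M i)))).map
        (LinearMap.fst F (Fin l → F) (Fin (n - l) → F))) := by
    intro M
    rw [Matrix.rank_eq_finrank_span_row, Submodule.map_span, ← Set.range_comp]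
    rw [LinearEquiv.finrank_eq (Submodule.equivMapOfInjective h hh _), Submodule.map_span,
      ← Set.range_comp]
    suffices hs : (M * N.transpose).row =
        h ∘ (LinearMap.fst F (Fin l → F) (Fin (n - l) → F)) ∘ fun i => e (M i) by rw [hs]
    funext i j
    have := congrFun (hg (M i)) j
    simp only [Function.comp, LinearMap.fst_apply]
    rw [← this]
    simp [Matrix.mul_apply, Matrix.mulVec, dotProduct, mul_comm]
  have hcount := card_fam (F := F) (V := (Fin l → F) × (Fin (n - l) → F)) m
    (fun W => Module.finrank F (W.map (LinearMap.fst F (Fin l → F) (Fin (n - l) → F))) = k)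
  rw [card_subs k m (hkl.trans hlm), hq] at hcount
  have hE : Module.finrank F (Fin (n - l) → F) - (m - k) = n + k - l - m := by
    rw [Module.finrank_fin_fun]; omega
  rw [hE] at hcount
  rw [← Nat.card_coe_set_eq]
  refine Eq.trans (Nat.card_congr (Equiv.subtypeEquiv
      (p := fun M : Matrix (Fin m) (Fin n) F => M.rank = m ∧ (M * N.transpose).rank = k)
      (q := fun v : Fin m → (Fin l → F) × (Fin (n - l) → F) => LinearIndependent F v ∧
        Module.finrank F ((Submodule.span F (Set.range v)).map
          (LinearMap.fst F (Fin l → F) (Fin (n - l) → F))) = k)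
      (Equiv.piCongrRight fun _ : Fin m => e.toEquiv) ?_)) (hcount.trans ?_)
  · intro M
    rw [hrow, hprod]
    rfl
  · unfold Gq
    ring
end

section
/- Let F be a finite field with q elements and k, m, n positive integers with k ≤ min(m,n). (a) Every k-good pmf f on F^{m×n} satisfies |supp(f)| ≥ q^{k·max(m,n)}. (b) If a pmf f on F^{m×n} has |supp(f)| = q^{k·max(m,n)}, then f is k-good if and only if supp(f) is an (m,n,k) MRD code and f is the uniform distribution on supp(f). -/
open Matrix

theorem exists_left_ann {F : Type*} [Field F] {m p : ℕ} (j : ℕ) (D : Matrix (Fin m) (Fin p) F)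
    (h : j + D.rank ≤ m) : ∃ M : Matrix (Fin j) (Fin m) F, M.rank = j ∧ M * D = 0 := by
  have h1 : j ≤ Module.finrank F (LinearMap.ker Dᵀ.mulVecLin) := by
    have h2 := LinearMap.finrank_range_add_finrank_ker Dᵀ.mulVecLin
    have h3 : Module.finrank F (LinearMap.range Dᵀ.mulVecLin) = D.rank := by
      rw [← Matrix.rank_transpose D]; rfl
    simp only [Module.finrank_fintype_fun_eq_card, Fintype.card_fin] at h2
    omega
  obtain ⟨v, hv⟩ := exists_linearIndependent_of_le_finrank h1
  have hv' := hv.map' (LinearMap.ker Dᵀ.mulVecLin).subtype (Submodule.ker_subtype _)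
  refine ⟨Matrix.of (fun i => (v i : Fin m → F)), ?_, ?_⟩
  · have := LinearIndependent.rank_matrix (M := Matrix.of (fun i => (v i : Fin m → F))) hv'
    simpa using this
  · ext i l
    have := congrFun (LinearMap.mem_ker.1 (v i).2) l
    simp only [Matrix.mulVecLin_apply, Matrix.mulVec_transpose] at this
    simpa [Matrix.mul_apply, Matrix.vecMul, dotProduct] using this

theorem vecMul_inj_of_rank {F : Type*} [Field F] {k m : ℕ} (M : Matrix (Fin k) (Fin m) F)
    (hM : M.rank = k) : LinearMap.ker M.vecMulLinear = ⊥ := by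
  have h2 := LinearMap.finrank_range_add_finrank_ker M.vecMulLinear
  have h3 : Module.finrank F (LinearMap.range M.vecMulLinear) = M.rank := by
    rw [← Matrix.rank_transpose M, Matrix.rank, Matrix.mulVecLin_transpose]
  simp only [Module.finrank_fintype_fun_eq_card, Fintype.card_fin] at h2
  exact Submodule.finrank_eq_zero.1 (by omega)

theorem left_cancel {F : Type*} [Field F] {k m n : ℕ} (M : Matrix (Fin k) (Fin m) F)
    (hM : M.rank = k) (L : Matrix (Fin n) (Fin k) F) (h : L * M = 0) : L = 0 := by
  have h0 := vecMul_inj_of_rank M hM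
  ext i j
  have : L i ∈ LinearMap.ker M.vecMulLinear := by
    rw [LinearMap.mem_ker]
    ext l
    exact congrFun (congrFun h i) l
  rw [h0] at this
  exact congrFun ((Submodule.mem_bot F).1 this) j

theorem exists_factor {F : Type*} [Field F] {k m n : ℕ} (hkm : k ≤ m)
    (B : Matrix (Fin n) (Fin m) F) (hB : B.rank ≤ k) :
    ∃ (M : Matrix (Fin k) (Fin m) F) (L : Matrix (Fin n) (Fin k) F),
      M.rank = k ∧ B = L * M := by
  obtain ⟨N, hN, hNB⟩ := exists_left_ann (m - k) Bᵀ (by rw [Matrix.rank_transpose]; omega)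
  obtain ⟨M, hM, hMN⟩ := exists_left_ann k Nᵀ (by rw [Matrix.rank_transpose]; omega)
  have hle : LinearMap.range M.vecMulLinear ≤ LinearMap.ker N.mulVecLin := by
    rintro _ ⟨x, rfl⟩
    rw [LinearMap.mem_ker]
    simp only [Matrix.mulVecLin_apply, Matrix.vecMulLinear_apply]
    rw [← Matrix.vecMul_transpose, Matrix.vecMul_vecMul, hMN, Matrix.vecMul_zero]
  have heq : LinearMap.range M.vecMulLinear = LinearMap.ker N.mulVecLin := by
    apply Submodule.eq_of_le_of_finrank_eq hle
    have h2 := LinearMap.finrank_range_add_finrank_ker N.mulVecLin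
    have h3 : Module.finrank F (LinearMap.range M.vecMulLinear) = M.rank := by
      rw [← Matrix.rank_transpose M, Matrix.rank, Matrix.mulVecLin_transpose]
    have h4 : Module.finrank F (LinearMap.range N.mulVecLin) = N.rank := rfl
    simp only [Module.finrank_fintype_fun_eq_card, Fintype.card_fin] at h2
    omega
  have hrow : ∀ i, ∃ x : Fin k → F, M.vecMulLinear x = B i := by
    intro i
    have : B i ∈ LinearMap.ker N.mulVecLin := by
      rw [LinearMap.mem_ker]
      ext l
      have := congrFun (congrFun hNB l) i
      simpa [Matrix.mul_apply, Matrix.mulVec, dotProduct] using this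
    rw [← heq] at this
    exact this
  choose L hL using hrow
  refine ⟨M, Matrix.of L, hM, ?_⟩
  ext i j
  have := congrFun (hL i) j
  rw [← this]
  simp [Matrix.mul_apply, Matrix.vecMul, dotProduct]

theorem card_fiber {F W : Type*} [Field F] [Fintype F] [DecidableEq F] [AddCommGroup W]
    [Fintype W] [Module F W] (φ : W →ₗ[F] F) (hφ : φ ≠ 0) (c : F) :
    (Finset.univ.filter fun w => φ w = c).card * Fintype.card F = Fintype.card W := by
  classical
  have hs : Function.Surjective φ := LinearMap.surjective hφ
  have key : ∀ d : F, (Finset.univ.filter fun w => φ w = d).card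
      = (Finset.univ.filter fun w => φ w = c).card := by
    intro d
    obtain ⟨w0, hw0⟩ := hs (c - d)
    apply Finset.card_bij (fun w _ => w + w0)
    · intro a ha
      simp only [Finset.mem_filter, Finset.mem_univ, true_and] at ha ⊢
      rw [map_add, ha, hw0]; ring
    · intro a _ b _ h
      exact add_right_cancel h
    · intro b hb
      simp only [Finset.mem_filter, Finset.mem_univ, true_and] at hb
      refine ⟨b - w0, ?_, by simp⟩
      simp only [Finset.mem_filter, Finset.mem_univ, true_and]
      rw [map_sub, hb, hw0]; ring
  have h := Finset.card_eq_sum_card_fiberwise (f := φ) (s := Finset.univ) (t := Finset.univ)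
    (fun _ _ => by simp)
  rw [Finset.sum_congr rfl (fun d _ => key d)] at h
  simp only [Finset.sum_const, Finset.card_univ, smul_eq_mul] at h
  rw [h, mul_comm]

theorem exists_trace_ne {F : Type*} [Field F] {k n : ℕ} (L : Matrix (Fin n) (Fin k) F)
    (hL : L ≠ 0) : ∃ K : Matrix (Fin k) (Fin n) F, (L * K).trace ≠ 0 := by
  by_contra! h
  apply hL
  ext i j
  have := h (Matrix.single j i 1)
  simpa [Matrix.trace_mul_single] using this

theorem card_mat {F : Type*} [Fintype F] (k n : ℕ) :
    Fintype.card (Matrix (Fin k) (Fin n) F) = Fintype.card F ^ (k * n) := by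
  have : Fintype.card (Fin k → Fin n → F) = Fintype.card F ^ (k * n) := by
    simp [← pow_mul, mul_comm]
  rw [← this]
  exact Fintype.card_congr (Equiv.refl _)

theorem card_trace_left {F : Type*} [Field F] [Fintype F] [DecidableEq F] {k n : ℕ}
    (L : Matrix (Fin n) (Fin k) F) (hL : L ≠ 0) (c : F) :
    (Finset.univ.filter fun K : Matrix (Fin k) (Fin n) F => (L * K).trace = c).card
      * Fintype.card F = Fintype.card F ^ (k * n) := by
  let φ : Matrix (Fin k) (Fin n) F →ₗ[F] F :=
    { toFun := fun K => (L * K).trace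
      map_add' := fun x y => by rw [Matrix.mul_add, Matrix.trace_add]
      map_smul' := fun a x => by rw [Matrix.mul_smul, Matrix.trace_smul]; rfl }
  have hφ : φ ≠ 0 := by
    obtain ⟨K, hK⟩ := exists_trace_ne L hL
    intro h
    exact hK (LinearMap.congr_fun h K)
  have := card_fiber φ hφ c
  have e : Fintype.card (Matrix (Fin k) (Fin n) F) = Fintype.card F ^ (k * n) := by
    exact card_mat k n
  rw [← e, ← this]
  rfl

def IsTrGood (q k : ℕ) {F : Type*} [Field F] [Fintype F] [DecidableEq F] {m n : ℕ}
    (f : Matrix (Fin m) (Fin n) F → ℝ) : Prop :=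
  ∀ B : Matrix (Fin n) (Fin m) F, B ≠ 0 → B.rank ≤ k → ∀ c : F,
    ∑ A ∈ Finset.univ.filter fun A : Matrix (Fin m) (Fin n) F => (B * A).trace = c, f A
      = (q : ℝ)⁻¹

theorem IsKGood.trGood {F : Type*} [Field F] [Fintype F] [DecidableEq F] {q k m n : ℕ}
    (hq : Fintype.card F = q) (hkm : k ≤ m)
    {f : Matrix (Fin m) (Fin n) F → ℝ} (h : IsKGood q k f) : IsTrGood q k f := by
  intro B hB hr c
  obtain ⟨M, L, hM, rfl⟩ := exists_factor hkm B hr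
  have hL : L ≠ 0 := by
    rintro rfl
    simp at hB
  have hq0 : (0 : ℝ) < q := by
    rw [← hq]; exact_mod_cast Fintype.card_pos
  have h1 := Finset.sum_fiberwise_of_maps_to
    (s := Finset.univ.filter fun A : Matrix (Fin m) (Fin n) F => (L * M * A).trace = c)
    (t := Finset.univ.filter fun K : Matrix (Fin k) (Fin n) F => (L * K).trace = c)
    (g := fun A => M * A) (by
      intro A hA
      simpa [Matrix.mul_assoc] using hA) f
  rw [← h1]
  have h2 : ∀ K ∈ Finset.univ.filter fun K : Matrix (Fin k) (Fin n) F => (L * K).trace = c,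
      ∑ A ∈ (Finset.univ.filter fun A : Matrix (Fin m) (Fin n) F => (L * M * A).trace = c).filter
        (fun A => M * A = K), f A = ((q : ℝ) ^ (k * n))⁻¹ := by
    intro K hK
    rw [← h M hM K, Finset.filter_filter]
    apply Finset.sum_congr _ (fun _ _ => rfl)
    ext A
    simp only [Finset.mem_filter, Finset.mem_univ, true_and] at hK ⊢
    constructor
    · exact fun h => h.2
    · intro h
      exact ⟨by rw [Matrix.mul_assoc, h, hK], h⟩
  rw [Finset.sum_congr rfl h2, Finset.sum_const, nsmul_eq_mul]
  have h3 := card_trace_left L hL c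
  rw [hq] at h3
  have h4 : ((Finset.univ.filter fun K : Matrix (Fin k) (Fin n) F => (L * K).trace = c).card : ℝ)
      * q = (q : ℝ) ^ (k * n) := by exact_mod_cast h3
  rw [← h4]
  have : ((Finset.univ.filter fun K : Matrix (Fin k) (Fin n) F => (L * K).trace = c).card : ℝ)
      ≠ 0 := by
    intro h0
    rw [h0, zero_mul] at h4
    exact (pow_pos hq0 _).ne h4
  field_simp

theorem IsTrGood.kGood {F : Type*} [Field F] [Fintype F] [DecidableEq F] {q k m n : ℕ}
    (hq : Fintype.card F = q)
    {f : Matrix (Fin m) (Fin n) F → ℝ} (hf : ∑ A, f A = 1) (h : IsTrGood q k f) :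
    IsKGood q k f := by
  intro M hM K
  have hq1 : (1 : ℝ) < q := by
    rw [← hq]; exact_mod_cast Fintype.one_lt_card
  have hQ0 : (0 : ℝ) < (q : ℝ) ^ (k * n) := by positivity
  set Q : ℝ := (q : ℝ) ^ (k * n) with hQ
  set S := ∑ A ∈ Finset.univ.filter fun A : Matrix (Fin m) (Fin n) F => M * A = K, f A with hS
  have hcardN : Fintype.card (Matrix (Fin n) (Fin k) F) = q ^ (k * n) := by
    rw [card_mat, hq, mul_comm]
  -- first evaluation
  have e1 : ∑ L : Matrix (Fin n) (Fin k) F,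
      ∑ A : Matrix (Fin m) (Fin n) F, (if (L * M * A).trace = (L * K).trace then f A else 0)
      = 1 + (Q - 1) * (q : ℝ)⁻¹ := by
    rw [← Finset.add_sum_erase _ _ (Finset.mem_univ (0 : Matrix (Fin n) (Fin k) F))]
    have : ∀ L ∈ (Finset.univ : Finset (Matrix (Fin n) (Fin k) F)).erase 0,
        ∑ A : Matrix (Fin m) (Fin n) F, (if (L * M * A).trace = (L * K).trace then f A else 0)
        = (q : ℝ)⁻¹ := by
      intro L hL
      rw [← Finset.sum_filter]
      apply h
      · intro h0
        exact (Finset.ne_of_mem_erase hL) (left_cancel M hM L h0)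
      · exact (Matrix.rank_mul_le_right L M).trans hM.le
    rw [Finset.sum_congr rfl this, Finset.sum_const, nsmul_eq_mul]
    congr 1
    · simp [hf]
    · rw [Finset.card_erase_of_mem (Finset.mem_univ _), Finset.card_univ, hcardN,
        Nat.cast_sub (Nat.one_le_pow _ _ (by exact_mod_cast (zero_lt_one.trans hq1)))]
      simp [hQ]
  have e2 : ∑ L : Matrix (Fin n) (Fin k) F,
      ∑ A : Matrix (Fin m) (Fin n) F, (if (L * M * A).trace = (L * K).trace then f A else 0)
      = ∑ A : Matrix (Fin m) (Fin n) F,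
        (Q * (q : ℝ)⁻¹ * f A + (if M * A = K then (Q - Q * (q : ℝ)⁻¹) * f A else 0)) := by
    rw [Finset.sum_comm]
    apply Finset.sum_congr rfl
    intro A _
    rw [← Finset.sum_filter, Finset.sum_const, nsmul_eq_mul]
    have hset : (Finset.univ.filter fun L : Matrix (Fin n) (Fin k) F =>
        (L * M * A).trace = (L * K).trace) =
        Finset.univ.filter fun L : Matrix (Fin n) (Fin k) F => ((M * A - K) * L).trace = 0 := by
      ext L
      simp only [Finset.mem_filter, Finset.mem_univ, true_and]
      rw [Matrix.trace_mul_comm (M * A - K), Matrix.mul_sub, Matrix.trace_sub, sub_eq_zero,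
        Matrix.mul_assoc]
    rw [hset]
    by_cases hA : M * A = K
    · simp only [hA, sub_self, Matrix.zero_mul, Matrix.trace_zero, Finset.filter_true,
        Finset.card_univ, hcardN, if_true]
      push_cast
      rw [← hQ]; ring
    · rw [if_neg hA]
      have h3 := card_trace_left (M * A - K) (sub_ne_zero.2 hA) 0
      rw [hq, mul_comm n k] at h3
      have h4 : ((Finset.univ.filter fun L : Matrix (Fin n) (Fin k) F =>
        ((M * A - K) * L).trace = 0).card : ℝ) * q = Q := by rw [hQ]; exact_mod_cast h3
      rw [← h4]
      field_simp
      ring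
  rw [e1, Finset.sum_add_distrib, ← Finset.mul_sum, hf, ← Finset.sum_filter, ← Finset.mul_sum,
    ← hS] at e2
  have h5 : S * Q * (1 - (q : ℝ)⁻¹) = 1 - (q : ℝ)⁻¹ := by linear_combination -e2
  have h6 : (1 - (q : ℝ)⁻¹) ≠ 0 := by
    have := inv_lt_one_of_one_lt₀ hq1
    linarith
  have h7 : S * Q = 1 := by
    apply mul_right_cancel₀ h6
    rw [h5, one_mul]
  exact eq_inv_of_mul_eq_one_left h7

theorem sum_transpose {F : Type*} [Fintype F] [DecidableEq F] {m n : ℕ}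
    (f : Matrix (Fin m) (Fin n) F → ℝ) :
    ∑ A : Matrix (Fin n) (Fin m) F, f Aᵀ = ∑ A, f A :=
  Fintype.sum_equiv ⟨Matrix.transpose, Matrix.transpose, fun _ => rfl, fun _ => rfl⟩ _ _
    (fun _ => rfl)

theorem IsTrGood.transpose {F : Type*} [Field F] [Fintype F] [DecidableEq F] {q k m n : ℕ}
    {f : Matrix (Fin m) (Fin n) F → ℝ} (h : IsTrGood q k f) :
    IsTrGood q k (fun A : Matrix (Fin n) (Fin m) F => f Aᵀ) := by
  intro B hB hr c
  have := h Bᵀ (by simpa using hB) (by rwa [Matrix.rank_transpose]) c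
  rw [← this, Finset.sum_filter, Finset.sum_filter, ← sum_transpose]
  apply Finset.sum_congr rfl
  intro A _
  rw [← Matrix.trace_transpose (Bᵀ * A), Matrix.transpose_mul, Matrix.transpose_transpose,
    Matrix.trace_mul_comm, Matrix.transpose_transpose]

theorem IsKGood.transpose {F : Type*} [Field F] [Fintype F] [DecidableEq F] {q k m n : ℕ}
    (hq : Fintype.card F = q) (hkm : k ≤ m)
    {f : Matrix (Fin m) (Fin n) F → ℝ} (hf : ∑ A, f A = 1) (h : IsKGood q k f) :
    IsKGood q k (fun A : Matrix (Fin n) (Fin m) F => f Aᵀ) :=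
  (h.trGood hq hkm).transpose.kGood hq (by rw [sum_transpose, hf])

theorem support_surj {F : Type*} [Field F] [Fintype F] [DecidableEq F] {q k m n : ℕ}
    (hq : Fintype.card F = q)
    {f : Matrix (Fin m) (Fin n) F → ℝ} (h : IsKGood q k f)
    (M : Matrix (Fin k) (Fin m) F) (hM : M.rank = k) (K : Matrix (Fin k) (Fin n) F) :
    ∃ A, f A ≠ 0 ∧ M * A = K := by
  have hq0 : (0 : ℝ) < q := by
    rw [← hq]; exact_mod_cast Fintype.card_pos
  have h1 := h M hM K
  have h2 : ∑ A ∈ Finset.univ.filter fun A : Matrix (Fin m) (Fin n) F => M * A = K, f A ≠ 0 := by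
    rw [h1]; positivity
  obtain ⟨A, hA, hfA⟩ := Finset.exists_ne_zero_of_sum_ne_zero h2
  exact ⟨A, hfA, by simpa using hA⟩

theorem supp_ncard {F : Type*} [Fintype F] {m n : ℕ}
    (f : Matrix (Fin m) (Fin n) F → ℝ) [DecidablePred fun A => f A ≠ 0] :
    (Function.support f).ncard = (Finset.univ.filter fun A => f A ≠ 0).card := by
  rw [← Set.ncard_coe_finset]
  congr 1
  ext A
  simp

theorem core_a {F : Type*} [Field F] [Fintype F] [DecidableEq F] {q k m n : ℕ}
    (hq : Fintype.card F = q) (hkm : k ≤ m)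
    {f : Matrix (Fin m) (Fin n) F → ℝ} (h : IsKGood q k f) :
    q ^ (k * n) ≤ (Function.support f).ncard := by
  classical
  obtain ⟨M, hM, -⟩ := exists_left_ann k (0 : Matrix (Fin m) (Fin 0) F) (by simpa using hkm)
  rw [supp_ncard, ← hq, ← card_mat, ← Finset.card_univ]
  apply Finset.card_le_card_of_surjOn (fun A => M * A)
  intro K _
  obtain ⟨A, h1, h2⟩ := support_surj hq h M hM K
  exact ⟨A, by simpa using h1, h2⟩

theorem core_b {F : Type*} [Field F] [Fintype F] [DecidableEq F] {q k m n : ℕ}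
    (hq : Fintype.card F = q) (hk : 0 < k) (hkm : k ≤ m) (hmn : m ≤ n)
    {f : Matrix (Fin m) (Fin n) F → ℝ}
    (hc : (Function.support f).ncard = q ^ (k * n)) :
    IsKGood q k f ↔ rankDist (Function.support f) = m - k + 1 ∧
            ∀ A ∈ Function.support f, f A = ((q : ℝ) ^ (k * n))⁻¹ := by
  classical
  have hq1 : 1 < q := by
    rw [← hq]; exact Fintype.one_lt_card
  have hc' := hc
  rw [supp_ncard] at hc'
  have hcard : (Finset.univ.filter fun A => f A ≠ 0).card
      = (Finset.univ : Finset (Matrix (Fin k) (Fin n) F)).card := by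
    rw [hc', Finset.card_univ, card_mat, hq]
  constructor
  · intro h
    have hinj : ∀ M : Matrix (Fin k) (Fin m) F, M.rank = k → ∀ X Y, f X ≠ 0 → f Y ≠ 0 →
        M * X = M * Y → X = Y := by
      intro M hM X Y hX hY hXY
      have : Set.InjOn (fun A : Matrix (Fin m) (Fin n) F => M * A)
          (Finset.univ.filter fun A : Matrix (Fin m) (Fin n) F => f A ≠ 0) := by
        apply Finset.injOn_of_surjOn_of_card_le (t := Finset.univ) _ (by intro _ _; simp) _ hcard.le
        intro K _
        obtain ⟨A, h1, h2⟩ := support_surj hq h M hM K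
        exact ⟨A, by simpa using h1, h2⟩
      exact this (by simpa using hX) (by simpa using hY) hXY
    constructor
    · unfold rankDist
      have hex : ∃ X, f X ≠ 0 ∧ ∃ Y, f Y ≠ 0 ∧ X ≠ Y ∧ (X - Y).rank ≤ m - k + 1 := by
        obtain ⟨M, hM, -⟩ := exists_left_ann (k - 1) (0 : Matrix (Fin m) (Fin 0) F)
          (by simp; omega)
        have hlt : (Finset.univ : Finset (Matrix (Fin (k - 1)) (Fin n) F)).card
            < (Finset.univ.filter fun A => f A ≠ 0).card := by
          rw [hc', Finset.card_univ, card_mat, hq]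
          apply Nat.pow_lt_pow_right hq1
          apply Nat.mul_lt_mul_of_pos_right <;> omega
        obtain ⟨X, hX, Y, hY, hne, hXY⟩ := Finset.exists_ne_map_eq_of_card_lt_of_maps_to hlt
          (f := fun A => M * A) (by intro _ _; simp)
        refine ⟨X, by simpa using hX, Y, by simpa using hY, hne, ?_⟩
        have : M * (X - Y) = 0 := by rw [Matrix.mul_sub, sub_eq_zero]; exact hXY
        have := Matrix.rank_add_rank_le_card_of_mul_eq_zero this
        rw [hM, Fintype.card_fin] at this
        omega
      obtain ⟨X, hX, Y, hY, hne, hr⟩ := hex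
      apply le_antisymm
      · refine le_trans (Nat.sInf_le ?_) hr
        exact ⟨X, hX, Y, hY, hne, rfl⟩
      · refine le_csInf ⟨(X - Y).rank, ⟨X, hX, Y, hY, hne, rfl⟩⟩ ?_
        rintro r ⟨X', hX', Y', hY', hne', rfl⟩
        by_contra! hlt
        obtain ⟨M, hM, hM0⟩ := exists_left_ann k (X' - Y') (by omega)
        apply hne'
        apply hinj M hM _ _ hX' hY'
        rwa [Matrix.mul_sub, sub_eq_zero] at hM0
    · intro A hA
      obtain ⟨M, hM, -⟩ := exists_left_ann k (0 : Matrix (Fin m) (Fin 0) F) (by simpa using hkm)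
      rw [← h M hM (M * A)]
      symm
      apply Finset.sum_eq_single A
      · intro B hB hBA
        by_contra hfB
        exact hBA (hinj M hM _ _ hfB hA (by simpa using hB))
      · intro hn
        simp at hn
  · rintro ⟨hd, hu⟩ M hM K
    have hinj : ∀ X Y, f X ≠ 0 → f Y ≠ 0 → M * X = M * Y → X = Y := by
      intro X Y hX hY hXY
      by_contra hne
      have h1 : rankDist (Function.support f) ≤ (X - Y).rank :=
        Nat.sInf_le ⟨X, hX, Y, hY, hne, rfl⟩
      have : M * (X - Y) = 0 := by rw [Matrix.mul_sub, sub_eq_zero]; exact hXY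
      have := Matrix.rank_add_rank_le_card_of_mul_eq_zero this
      rw [hM, Fintype.card_fin] at this
      omega
    have hsurj : Set.SurjOn (fun A : Matrix (Fin m) (Fin n) F => M * A)
        (Finset.univ.filter fun A : Matrix (Fin m) (Fin n) F => f A ≠ 0)
        (Finset.univ : Finset (Matrix (Fin k) (Fin n) F)) := by
      apply Finset.surjOn_of_injOn_of_card_le _ (by intro _ _; simp) _ hcard.ge
      intro X hX Y hY hXY
      exact hinj X Y (by simpa using hX) (by simpa using hY) hXY
    obtain ⟨A, hA, hAK⟩ := hsurj (show K ∈ _ by simp)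
    have hA' : f A ≠ 0 := by simpa using hA
    rw [← hu A hA']
    apply Finset.sum_eq_single A
    · intro B hB hBA
      by_contra hfB
      simp only [Finset.mem_filter, Finset.mem_univ, true_and] at hB
      exact hBA (hinj _ _ hfB hA' (hB.trans hAK.symm))
    · intro hn
      exact absurd hAK (by simpa using hn)

theorem support_transpose_ncard {F : Type*} {m n : ℕ}
    (f : Matrix (Fin m) (Fin n) F → ℝ) :
    (Function.support (fun A : Matrix (Fin n) (Fin m) F => f Aᵀ)).ncard
      = (Function.support f).ncard := by
  apply Set.ncard_congr (fun A _ => Aᵀ)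
  · intro A hA
    exact hA
  · intro A B _ _ h
    exact Matrix.transpose_injective h
  · intro B hB
    exact ⟨Bᵀ, hB, rfl⟩

theorem rankDist_transpose {F : Type*} [Field F] [Fintype F] {m n : ℕ}
    (f : Matrix (Fin m) (Fin n) F → ℝ) :
    rankDist (Function.support (fun A : Matrix (Fin n) (Fin m) F => f Aᵀ))
      = rankDist (Function.support f) := by
  unfold rankDist
  congr 1
  ext r
  constructor
  · rintro ⟨X, hX, Y, hY, hne, hr⟩
    refine ⟨Xᵀ, hX, Yᵀ, hY, fun h => hne (Matrix.transpose_injective h), ?_⟩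
    rw [← Matrix.transpose_sub, Matrix.rank_transpose, hr]
  · rintro ⟨X, hX, Y, hY, hne, hr⟩
    refine ⟨Xᵀ, hX, Yᵀ, hY, fun h => hne (Matrix.transpose_injective h), ?_⟩
    rw [← Matrix.transpose_sub, Matrix.rank_transpose, hr]

/-- (a) Every `k`-good pmf on `F^{m×n}` has support of size at least `q^(k·max m n)`.
(b) A pmf with support of size exactly `q^(k·max m n)` is `k`-good iff its support is an
`(m,n,k)` MRD code and the pmf is uniform on its support. -/
theorem stmt9 {F : Type*} [Field F] [Fintype F] [DecidableEq F] (q k m n : ℕ)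
    (hq : Fintype.card F = q) (hk : 0 < k) (hkm : k ≤ m) (hkn : k ≤ n)
    (f : Matrix (Fin m) (Fin n) F → ℝ) (hf : IsPmf f) :
    (IsKGood q k f → q ^ (k * max m n) ≤ (Function.support f).ncard) ∧
      ((Function.support f).ncard = q ^ (k * max m n) →
        (IsKGood q k f ↔
          IsMRD q k (Function.support f) ∧
            ∀ A ∈ Function.support f, f A = ((q : ℝ) ^ (k * max m n))⁻¹)) := by
  have hkg : IsKGood q k f ↔ IsKGood q k (fun A : Matrix (Fin n) (Fin m) F => f Aᵀ) := by
    constructor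
    · exact fun h => h.transpose hq hkm hf.2
    · exact fun h => h.transpose hq hkn (by rw [sum_transpose, hf.2])
  constructor
  · intro h
    rcases le_total m n with hmn | hmn
    · rw [max_eq_right hmn]
      exact core_a hq hkm h
    · rw [max_eq_left hmn, ← support_transpose_ncard]
      exact core_a hq hkn (hkg.1 h)
  · intro hc
    unfold IsMRD
    rcases le_total m n with hmn | hmn
    · rw [max_eq_right hmn] at hc
      rw [max_eq_right hmn, min_eq_left hmn, core_b hq hk hkm hmn hc]
      exact ⟨fun h => ⟨⟨hc, h.1⟩, h.2⟩, fun h => ⟨h.1.2, h.2⟩⟩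
    · rw [max_eq_left hmn] at hc
      rw [max_eq_left hmn, min_eq_right hmn, hkg,
        core_b hq hk hkn hmn (by rw [support_transpose_ncard, hc]), rankDist_transpose]
      exact ⟨fun h => ⟨⟨hc, h.1⟩, fun A hA => h.2 Aᵀ hA⟩,
        fun h => ⟨h.1.2, fun A hA => h.2 Aᵀ hA⟩⟩
end

section
/- Let F be a finite field with q elements and m, n positive integers. If a pmf f on F^{m×n} is min(m,n)-good, then f is the uniform distribution on F^{m×n}, i.e. f(A) = q^{-mn} for every A ∈ F^{m×n}. -/
open Matrix

/-- Every `n × m` matrix with `n ≤ m` factors through a full-rank `n × m` matrix. -/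
lemma exists_fullrank_factor {F : Type*} [Field F] {m n : ℕ} (h : n ≤ m)
    (B : Matrix (Fin n) (Fin m) F) :
    ∃ (C : Matrix (Fin n) (Fin n) F) (M : Matrix (Fin n) (Fin m) F), M.rank = n ∧ B = C * M := by
  have h1 : Module.finrank F (Submodule.span F (Set.range B)) ≤ n := by
    have := finrank_range_le_card (R := F) (b := B)
    simpa [Set.finrank] using this
  have h2 : n ≤ Module.finrank F (Fin m → F) := by simpa using h
  obtain ⟨W, hle, hW⟩ : ∃ W : Submodule F (Fin m → F),
      Submodule.span F (Set.range B) ≤ W ∧ Module.finrank F W = n := by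
    obtain ⟨U, hU⟩ := Submodule.exists_isCompl (Submodule.span F (Set.range B))
    have hsum := Submodule.finrank_add_eq_of_isCompl hU
    obtain ⟨V, hVU, hV⟩ : ∃ V : Submodule F (Fin m → F), V ≤ U ∧
        Module.finrank F V = n - Module.finrank F (Submodule.span F (Set.range B)) := by
      have hr : n - Module.finrank F (Submodule.span F (Set.range B)) ≤ Module.finrank F U := by
        omega
      let c := Module.finBasis F U
      have hli : LinearIndependent F (fun j => (c (Fin.castLE hr j) : Fin m → F)) :=
        (c.linearIndependent.map' U.subtype (Submodule.ker_subtype U)).comp _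
          (Fin.castLE_injective hr)
      refine ⟨Submodule.span F (Set.range (fun j => (c (Fin.castLE hr j) : Fin m → F))), ?_, ?_⟩
      · rw [Submodule.span_le]
        rintro _ ⟨j, rfl⟩
        exact (c (Fin.castLE hr j)).2
      · rw [finrank_span_eq_card hli, Fintype.card_fin]
    refine ⟨Submodule.span F (Set.range B) ⊔ V, le_sup_left, ?_⟩
    have h3 := Submodule.finrank_sup_add_finrank_inf_eq (Submodule.span F (Set.range B)) V
    have h4 : Submodule.span F (Set.range B) ⊓ V = ⊥ :=
      (hU.disjoint.mono_right hVU).eq_bot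
    rw [h4, finrank_bot] at h3
    omega
  let b := Module.finBasisOfFinrankEq F W hW
  have hB : ∀ i, B i ∈ W := fun i => hle (Submodule.subset_span ⟨i, rfl⟩)
  refine ⟨Matrix.of fun i j => b.repr ⟨B i, hB i⟩ j, Matrix.of fun j => (b j : Fin m → F), ?_, ?_⟩
  · have hli : LinearIndependent F (fun j => (b j : Fin m → F)) :=
      b.linearIndependent.map' W.subtype (Submodule.ker_subtype W)
    have := LinearIndependent.rank_matrix (M := Matrix.of fun j => (b j : Fin m → F)) hli
    simpa using this
  · ext i l
    have := congrArg (fun w : W => (w : Fin m → F) l) (b.sum_repr ⟨B i, hB i⟩)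
    simp only [Submodule.coe_sum, Submodule.coe_smul, Finset.sum_apply, Pi.smul_apply,
      smul_eq_mul] at this
    simp only [Matrix.mul_apply, Matrix.of_apply]
    exact this.symm

/-- Counting the annihilator of a nonzero matrix. -/
lemma card_trace_zero {F : Type*} [Field F] [Fintype F] [DecidableEq F] {m n : ℕ}
    (D : Matrix (Fin m) (Fin n) F) (hD : D ≠ 0) :
    Fintype.card F * (Finset.univ.filter fun B : Matrix (Fin n) (Fin m) F =>
      (B * D).trace = 0).card = Fintype.card (Matrix (Fin n) (Fin m) F) := by
  let φ : Matrix (Fin n) (Fin m) F →ₗ[F] F :=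
    { toFun := fun B => (B * D).trace
      map_add' := fun x y => by simp [Matrix.add_mul]
      map_smul' := fun c x => by simp }
  have hφ : φ ≠ 0 := by
    intro h0
    apply hD
    apply Matrix.ext_iff_trace_mul_left.mpr
    intro B
    have := LinearMap.congr_fun h0 B
    simpa [φ] using this
  have hs : Function.Surjective φ := LinearMap.surjective hφ
  have h1 := Submodule.card_eq_card_quotient_mul_card (LinearMap.ker φ)
  rw [Nat.card_congr (φ.quotKerEquivOfSurjective hs).toEquiv, Nat.card_eq_fintype_card] at h1
  have h2 : Nat.card (LinearMap.ker φ) = (Finset.univ.filter fun B : Matrix (Fin n) (Fin m) F =>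
      (B * D).trace = 0).card := by
    rw [← Fintype.card_subtype, ← Nat.card_eq_fintype_card]
    rfl
  rw [← h2, h1, Nat.card_eq_fintype_card (α := F), mul_comm]

/-- A function all of whose trace-hyperplane sums vanish is zero. -/
lemma eq_zero_of_sums {F : Type*} [Field F] [Fintype F] [DecidableEq F] {m n : ℕ}
    (g : Matrix (Fin m) (Fin n) F → ℝ)
    (hg : ∀ (B : Matrix (Fin n) (Fin m) F) (t : F),
      ∑ A, (if (B * A).trace = t then g A else 0) = 0)
    (A₀ : Matrix (Fin m) (Fin n) F) : g A₀ = 0 := by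
  have hsum : ∑ A, g A = 0 := by simpa using hg 0 0
  have h1 : ∑ B : Matrix (Fin n) (Fin m) F, ∑ A,
      (if (B * A).trace = (B * A₀).trace then g A else 0) = 0 :=
    Finset.sum_eq_zero fun B _ => hg B _
  rw [Finset.sum_comm] at h1
  set T : ℝ := (Fintype.card (Matrix (Fin n) (Fin m) F) : ℝ) with hT
  have h2 : ∀ A, (Fintype.card F : ℝ) * ∑ B : Matrix (Fin n) (Fin m) F,
      (if (B * A).trace = (B * A₀).trace then g A else 0)
      = T * g A + if A = A₀ then ((Fintype.card F : ℝ) - 1) * T * g A else 0 := by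
    intro A
    by_cases hA : A = A₀
    · subst hA
      simp [hT]
      ring
    · have hc := card_trace_zero (A - A₀) (sub_ne_zero.mpr hA)
      have hc' : (Fintype.card F : ℝ) * ((Finset.univ.filter fun B : Matrix (Fin n) (Fin m) F =>
        (B * (A - A₀)).trace = 0).card : ℝ) = T := by rw [hT]; exact_mod_cast hc
      simp only [Matrix.mul_sub, Matrix.trace_sub, sub_eq_zero] at hc'
      rw [← Finset.sum_filter, Finset.sum_const, nsmul_eq_mul, ← mul_assoc, hc']
      simp [hA]
  have h3 : ∑ A, (T * g A + if A = A₀ then ((Fintype.card F : ℝ) - 1) * T * g A else 0) = 0 := by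
    rw [← Finset.sum_congr rfl (fun A _ => h2 A), ← Finset.mul_sum, h1, mul_zero]
  rw [Finset.sum_add_distrib, ← Finset.mul_sum, hsum] at h3
  simp only [mul_zero, zero_add, Finset.sum_ite_eq', Finset.mem_univ, if_true] at h3
  have hq1 : (1 : ℝ) < Fintype.card F := by exact_mod_cast Fintype.one_lt_card (α := F)
  have hT0 : T ≠ 0 := by
    rw [hT]; exact_mod_cast Fintype.card_ne_zero
  have := sub_ne_zero.mpr hq1.ne'
  simpa [hT0, this] using h3

/-- The only `min m n`-good random `m×n` matrix is the one uniformly distributed over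
`F^{m×n}`. -/
theorem stmt10 {F : Type*} [Field F] [Fintype F] [DecidableEq F] (q m n : ℕ)
    (hq : Fintype.card F = q) (hm : 0 < m) (hn : 0 < n)
    (f : Matrix (Fin m) (Fin n) F → ℝ) (hf : IsPmf f)
    (hgood : IsKGood q (min m n) f) :
    ∀ A : Matrix (Fin m) (Fin n) F, f A = ((q : ℝ) ^ (m * n))⁻¹ := by
  intro A₁
  rcases le_total m n with h | h
  · rw [min_eq_left h] at hgood
    have := hgood 1 (by simp) A₁
    simpa [Finset.filter_eq'] using this
  rw [min_eq_right h] at hgood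
  have hinv : ∀ D A, f A = f (A + D) := by
    intro D A
    have hz := eq_zero_of_sums (fun A => f A - f (A + D)) ?_ A
    · exact sub_eq_zero.mp hz
    intro B t
    obtain ⟨C, M, hM, rfl⟩ := exists_fullrank_factor h B
    have hK : ∀ K : Matrix (Fin n) (Fin n) F, ∑ A, (if M * A = K then f A - f (A + D) else 0) = 0 := by
      intro K
      have e1 := hgood M hM K
      have e2 := hgood M hM (K + M * D)
      rw [Finset.sum_filter] at e1 e2
      rw [← Equiv.sum_comp (Equiv.addRight D)] at e2
      simp only [Equiv.coe_addRight, Matrix.mul_add, add_left_inj] at e2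
      refine Eq.trans ?_ (sub_eq_zero.mpr (e1.trans e2.symm))
      rw [← Finset.sum_sub_distrib]
      refine Finset.sum_congr rfl fun A _ => ?_
      split_ifs <;> simp
    have hs : ∑ K : Matrix (Fin n) (Fin n) F, (if (C * K).trace = t then
        ∑ A, (if M * A = K then f A - f (A + D) else 0) else 0) = 0 :=
      Finset.sum_eq_zero fun K _ => by rw [hK K]; simp
    refine Eq.trans ?_ hs
    have hsw : ∀ K : Matrix (Fin n) (Fin n) F, (if (C * K).trace = t then
        ∑ A, (if M * A = K then f A - f (A + D) else 0) else 0)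
        = ∑ A, (if M * A = K then (if (C * K).trace = t then f A - f (A + D) else 0) else 0) := by
      intro K
      split_ifs <;> simp
    rw [Finset.sum_congr rfl (fun K _ => hsw K), Finset.sum_comm]
    refine Finset.sum_congr rfl fun A _ => ?_
    simp [Matrix.mul_assoc]
  have hconst : ∀ A, f A = f A₁ := fun A => by
    rw [hinv (A₁ - A) A]; simp
  have h1 := hf.2
  rw [Finset.sum_congr rfl (fun A _ => hconst A), Finset.sum_const, nsmul_eq_mul,
    Finset.card_univ] at h1
  have hc : (Fintype.card (Matrix (Fin m) (Fin n) F) : ℝ) = (q : ℝ) ^ (m * n) := by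
    have hc' : Fintype.card (Matrix (Fin m) (Fin n) F) = q ^ (m * n) := by
      rw [← Fintype.card_congr (Matrix.of (m := Fin m) (n := Fin n) (α := F))]
      simp [hq, ← pow_mul, mul_comm]
    exact_mod_cast hc'
  rw [hc] at h1
  exact eq_inv_of_mul_eq_one_right h1
end

section
/- Let F be a finite field with q elements and k, m, n, s, t positive integers with k ≤ s ≤ m and k ≤ t ≤ n. Let f be a k-good pmf on F^{m×n}, and let g be a pmf on the product space F^{s×m} × F^{n×t} × F^{s×t} such that g(P,Q,B) = 0 whenever rank(P) < s or rank(Q) < t. Then the pmf h on F^{s×t} defined by h(C) = ∑_{(A,P,Q,B) : P*A*Q + B = C} f(A)·g(P,Q,B) is a k-good pmf on F^{s×t}. -/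
open Matrix

lemma exists_right_inv_aux {F : Type*} [Field F] {a b : ℕ} (M : Matrix (Fin a) (Fin b) F)
    (h : M.rank = a) : ∃ N : Matrix (Fin b) (Fin a) F, M * N = 1 := by
  apply Matrix.mulVec_surjective_iff_exists_right_inverse.mp
  have h2 : LinearMap.range M.mulVecLin = ⊤ := by
    apply Submodule.eq_top_of_finrank_eq
    rw [Module.finrank_fin_fun]
    exact h
  exact LinearMap.range_eq_top.mp h2

lemma rank_of_right_inv_aux {F : Type*} [Field F] {a b : ℕ} (M : Matrix (Fin a) (Fin b) F)
    (N : Matrix (Fin b) (Fin a) F) (h : M * N = 1) : M.rank = a := by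
  apply le_antisymm
  · simpa using M.rank_le_height
  · have := Matrix.rank_mul_le_left M N
    rw [h, Matrix.rank_one, Fintype.card_fin] at this
    exact this

lemma fiber_card_aux {F : Type*} [Field F] [Fintype F] [DecidableEq F] (k n t : ℕ)
    (Q : Matrix (Fin n) (Fin t) F) (R : Matrix (Fin t) (Fin n) F) (h : R * Q = 1)
    (K : Matrix (Fin k) (Fin t) F) :
    Fintype.card F ^ (k * t) *
      (Finset.univ.filter fun L : Matrix (Fin k) (Fin n) F => L * Q = K).card
      = Fintype.card F ^ (k * n) := by
  have key : ∀ K' : Matrix (Fin k) (Fin t) F,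
      (Finset.univ.filter fun L : Matrix (Fin k) (Fin n) F => L * Q = K').card =
      (Finset.univ.filter fun L : Matrix (Fin k) (Fin n) F => L * Q = K).card := by
    intro K'
    refine Finset.card_bij' (fun L _ => L + (K - K') * R) (fun L _ => L - (K - K') * R) ?_ ?_ ?_ ?_
    · intro L hL
      simp only [Finset.mem_filter, Finset.mem_univ, true_and] at hL ⊢
      rw [Matrix.add_mul, hL, Matrix.mul_assoc, h, Matrix.mul_one]; abel
    · intro L hL
      simp only [Finset.mem_filter, Finset.mem_univ, true_and] at hL ⊢
      rw [Matrix.sub_mul, hL, Matrix.mul_assoc, h, Matrix.mul_one]; abel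
    · intro L _; simp
    · intro L _; simp
  have h1 := Finset.card_eq_sum_card_fiberwise (f := fun L : Matrix (Fin k) (Fin n) F => L * Q)
    (s := Finset.univ) (t := Finset.univ) (fun _ _ => by simp)
  simp only [key, Finset.sum_const, smul_eq_mul, Finset.card_univ] at h1
  have c : ∀ b : ℕ, Fintype.card (Matrix (Fin k) (Fin b) F) = Fintype.card F ^ (k * b) := by
    intro b
    rw [← Nat.card_eq_fintype_card, ← Nat.card_eq_fintype_card (α := F)]
    simp [Matrix, Nat.card_fun, ← pow_mul, mul_comm]
  rw [c, c] at h1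
  exact h1.symm

lemma inner_sum_aux {F : Type*} [Field F] [Fintype F] [DecidableEq F] (q k m n s t : ℕ)
    (hq : Fintype.card F = q)
    (f : Matrix (Fin m) (Fin n) F → ℝ) (hfg : IsKGood q k f)
    (P : Matrix (Fin s) (Fin m) F) (Q : Matrix (Fin n) (Fin t) F) (B : Matrix (Fin s) (Fin t) F)
    (hP : P.rank = s) (hQ : Q.rank = t) (M : Matrix (Fin k) (Fin s) F) (hM : M.rank = k)
    (K : Matrix (Fin k) (Fin t) F) :
    ∑ A : Matrix (Fin m) (Fin n) F, (if M * (P * A * Q + B) = K then f A else 0)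
      = ((q : ℝ) ^ (k * t))⁻¹ := by
  obtain ⟨S, hS⟩ := exists_right_inv_aux P hP
  obtain ⟨N, hN⟩ := exists_right_inv_aux M hM
  obtain ⟨R', hR'⟩ := exists_right_inv_aux Qᵀ (by rw [Matrix.rank_transpose, hQ])
  have hR : R'ᵀ * Q = 1 := by
    have := congrArg Matrix.transpose hR'
    simpa [Matrix.transpose_mul] using this
  have hMP : (M * P).rank = k := by
    apply rank_of_right_inv_aux _ (S * N)
    rw [Matrix.mul_assoc, ← Matrix.mul_assoc P, hS, Matrix.one_mul, hN]
  have e1 : ∀ A : Matrix (Fin m) (Fin n) F, (if M * (P * A * Q + B) = K then f A else 0)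
      = ∑ L ∈ Finset.univ.filter (fun L : Matrix (Fin k) (Fin n) F => L * Q = K - M * B),
          if (M * P) * A = L then f A else 0 := by
    intro A
    rw [Finset.sum_ite_eq]
    have : M * (P * A * Q + B) = K ↔ M * P * A * Q = K - M * B := by
      rw [Matrix.mul_add, eq_sub_iff_add_eq]
      simp only [Matrix.mul_assoc]
    simp [this]
  simp only [e1]
  rw [Finset.sum_comm]
  have e2 : ∀ L : Matrix (Fin k) (Fin n) F,
      ∑ A : Matrix (Fin m) (Fin n) F, (if (M * P) * A = L then f A else 0)
        = ((q : ℝ) ^ (k * n))⁻¹ := by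
    intro L
    rw [← Finset.sum_filter]
    exact hfg _ hMP L
  simp only [e2, Finset.sum_const, nsmul_eq_mul]
  have hc := fiber_card_aux k n t Q _ hR (K - M * B)
  rw [hq] at hc
  have hc' := congrArg (Nat.cast : ℕ → ℝ) hc
  push_cast at hc'
  have hq0 : (q : ℝ) ≠ 0 := by
    rw [← hq]; exact_mod_cast Fintype.card_ne_zero
  rw [← hc']
  have hpow : (q : ℝ) ^ (k * t) ≠ 0 := pow_ne_zero _ hq0
  have hcard : ((Finset.univ.filter fun L : Matrix (Fin k) (Fin n) F =>
      L * Q = K - M * B).card : ℝ) ≠ 0 := by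
    intro h0
    rw [h0, mul_zero] at hc'
    exact pow_ne_zero _ hq0 hc'.symm
  field_simp

/-- If `Ã` is a `k`-good random `m×n` matrix independent of `(P̃, Q̃, B̃)`, where
`P̃` is a random full-rank `s×m` matrix and `Q̃` a random full-rank `n×t` matrix,
then `P̃ Ã Q̃ + B̃` is a `k`-good random `s×t` matrix. -/
theorem stmt11 {F : Type*} [Field F] [Fintype F] [DecidableEq F] (q k m n s t : ℕ)
    (hq : Fintype.card F = q) (hk : 0 < k) (hks : k ≤ s) (hsm : s ≤ m)
    (hkt : k ≤ t) (htn : t ≤ n)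
    (f : Matrix (Fin m) (Fin n) F → ℝ) (hf : IsPmf f) (hfg : IsKGood q k f)
    (g : Matrix (Fin s) (Fin m) F × Matrix (Fin n) (Fin t) F × Matrix (Fin s) (Fin t) F → ℝ)
    (hg : IsPmf g)
    (hgrank : ∀ P Q B, (P : Matrix (Fin s) (Fin m) F).rank < s ∨
      (Q : Matrix (Fin n) (Fin t) F).rank < t → g (P, Q, B) = 0) :
    IsKGood q k (fun C : Matrix (Fin s) (Fin t) F =>
      ∑ A : Matrix (Fin m) (Fin n) F, ∑ P : Matrix (Fin s) (Fin m) F,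
        ∑ Q : Matrix (Fin n) (Fin t) F, ∑ B : Matrix (Fin s) (Fin t) F,
          if P * A * Q + B = C then f A * g (P, Q, B) else 0) := by
  intro M hM K
  have hg1 := hg.2
  rw [Fintype.sum_prod_type] at hg1
  simp only [Fintype.sum_prod_type] at hg1
  rw [Finset.sum_comm]
  have e : ∀ A : Matrix (Fin m) (Fin n) F,
      (∑ C ∈ Finset.univ.filter (fun C : Matrix (Fin s) (Fin t) F => M * C = K),
        ∑ P : Matrix (Fin s) (Fin m) F, ∑ Q : Matrix (Fin n) (Fin t) F,
          ∑ B : Matrix (Fin s) (Fin t) F,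
          if P * A * Q + B = C then f A * g (P, Q, B) else 0)
      = ∑ P : Matrix (Fin s) (Fin m) F, ∑ Q : Matrix (Fin n) (Fin t) F,
          ∑ B : Matrix (Fin s) (Fin t) F,
            (if M * (P * A * Q + B) = K then f A else 0) * g (P, Q, B) := by
    intro A
    rw [Finset.sum_comm]
    refine Finset.sum_congr rfl fun P _ => ?_
    rw [Finset.sum_comm]
    refine Finset.sum_congr rfl fun Q _ => ?_
    rw [Finset.sum_comm]
    refine Finset.sum_congr rfl fun B _ => ?_
    rw [Finset.sum_ite_eq]
    simp [ite_mul]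
  simp only [e]
  rw [← mul_one ((q : ℝ) ^ (k * t))⁻¹, ← hg1, Finset.mul_sum, Finset.sum_comm]
  refine Finset.sum_congr rfl fun P _ => ?_
  rw [Finset.mul_sum, Finset.sum_comm]
  refine Finset.sum_congr rfl fun Q _ => ?_
  rw [Finset.mul_sum, Finset.sum_comm]
  refine Finset.sum_congr rfl fun B _ => ?_
  rw [← Finset.sum_mul]
  by_cases h : P.rank < s ∨ Q.rank < t
  · rw [hgrank P Q B h, mul_zero, mul_zero]
  · rw [not_or, not_lt, not_lt] at h
    rw [inner_sum_aux q k m n s t hq f hfg P Q B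
      (le_antisymm (by simpa using P.rank_le_height) h.1)
      (le_antisymm (by simpa using Q.rank_le_width) h.2) M hM K]
end

section
/- Let F be a finite field with q elements and m, n positive integers. Define the left homogeneous weight w_hom : F^{m×n} → ℝ by w_hom(X) = 1 − (−1)^{rank X} / ∏_{i=0}^{rank X − 1} (q^{m−i} − 1) (an empty product being 1, so w_hom(0) = 0). Then the total weight satisfies ∑_{X ∈ F^{m×n}} w_hom(X) = q^{mn} − (−1)^m · q^{m(m+1)/2} · G_q(n−1, m). -/
open Matrix

open Module in
theorem aux_finrank_sup {F : Type*} [Field F] {m : ℕ} (S : Submodule F (Fin m → F))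
    (v : Fin m → F) (hv : v ∉ S) :
    finrank F (Submodule.span F {v} ⊔ S : Submodule F (Fin m → F)) = finrank F S + 1 := by
  have h0 : v ≠ 0 := fun h => hv (h ▸ S.zero_mem)
  have hd : Disjoint (Submodule.span F {v}) S := by
    rw [disjoint_comm]
    exact (Submodule.disjoint_span_singleton' h0).2 hv
  have h := Submodule.finrank_sup_add_finrank_inf_eq (Submodule.span F {v}) S
  rw [hd.eq_bot, finrank_bot, finrank_span_singleton h0] at h
  omega

open Module in
theorem aux_step {F : Type*} [Field F] [Fintype F] [DecidableEq F] {m : ℕ} (f : ℕ → ℝ)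
    (S : Submodule F (Fin m → F)) :
    ∑ v : Fin m → F, f (finrank F (Submodule.span F {v} ⊔ S : Submodule F (Fin m → F)))
      = (Fintype.card F : ℝ) ^ finrank F S * f (finrank F S)
        + ((Fintype.card F : ℝ) ^ m - (Fintype.card F : ℝ) ^ finrank F S)
            * f (finrank F S + 1) := by
  classical
  have h1 : ∀ v : Fin m → F,
      f (finrank F (Submodule.span F {v} ⊔ S : Submodule F (Fin m → F)))
      = f (finrank F S + 1) + if v ∈ S then (f (finrank F S) - f (finrank F S + 1)) else 0 := by
    intro v
    by_cases hv : v ∈ S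
    · have : Submodule.span F {v} ⊔ S = S := by
        simpa using hv
      rw [this]; simp [hv]
    · rw [aux_finrank_sup S v hv]; simp [hv]
  have hc : ((Finset.univ.filter (fun v : Fin m → F => v ∈ S)).card : ℝ)
      = (Fintype.card F : ℝ) ^ finrank F S := by
    have := Module.card_eq_pow_finrank (K := F) (V := S)
    rw [← Fintype.card_subtype]
    exact_mod_cast this
  rw [Finset.sum_congr rfl (fun v _ => h1 v), Finset.sum_add_distrib, ← Finset.sum_filter,
    Finset.sum_const, Finset.sum_const, nsmul_eq_mul, nsmul_eq_mul, hc]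
  simp
  ring

open Module in
theorem aux_sum_s12 {F : Type*} [Field F] [Fintype F] [DecidableEq F] {m n : ℕ} (f : ℕ → ℝ) :
    ∑ X : Matrix (Fin m) (Fin (n + 1)) F, f X.rank
      = ∑ Y : Matrix (Fin m) (Fin n) F, ((Fintype.card F : ℝ) ^ Y.rank * f Y.rank
        + ((Fintype.card F : ℝ) ^ m - (Fintype.card F : ℝ) ^ Y.rank) * f (Y.rank + 1)) := by
  have key : ∀ (k : ℕ) (g : ℕ → ℝ), ∑ X : Matrix (Fin m) (Fin k) F, g X.rank
      = ∑ c : Fin k → Fin m → F, g (finrank F (Submodule.span F (Set.range c))) := by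
    intro k g
    refine Fintype.sum_equiv (Equiv.piComm _) _ _ ?_
    intro X
    exact congrArg g (Matrix.rank_eq_finrank_span_cols (X : Matrix (Fin m) (Fin k) F))
  rw [key (n + 1) f, key n (fun r => (Fintype.card F : ℝ) ^ r * f r
        + ((Fintype.card F : ℝ) ^ m - (Fintype.card F : ℝ) ^ r) * f (r + 1)),
    ← (Fin.consEquiv (fun _ : Fin (n + 1) => Fin m → F)).sum_comp, Fintype.sum_prod_type,
    Finset.sum_comm]
  refine Finset.sum_congr rfl fun c _ => ?_
  rw [← aux_step]
  refine Finset.sum_congr rfl fun v _ => ?_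
  have hs : Submodule.span F (Set.range (Fin.consEquiv (fun _ : Fin (n + 1) => Fin m → F) (v, c)))
      = Submodule.span F {v} ⊔ Submodule.span F (Set.range c) := by
    simp only [Fin.consEquiv, Equiv.coe_fn_mk, Fin.range_cons, Submodule.span_insert]
  rw [hs]

open Module in
theorem aux_count {F : Type*} [Field F] [Fintype F] [DecidableEq F] (m n : ℕ) :
    Nat.card {Y : Matrix (Fin m) (Fin n) F // Y.rank = m}
      = Gq F n m * ∏ i : Fin m, (Fintype.card F ^ m - Fintype.card F ^ (i : ℕ)) := by
  classical
  have hspan : ∀ s : Fin m → Fin n → F, LinearIndependent F s ↔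
      finrank F (Submodule.span F (Set.range s)) = m := by
    intro s
    rw [linearIndependent_iff_card_eq_finrank_span, Fintype.card_fin, Set.finrank, eq_comm]
  let T := {W : Submodule F (Fin n → F) // finrank F W = m}
  let e : {Y : Matrix (Fin m) (Fin n) F // Y.rank = m} ≃
      Σ W : T, {s : Fin m → W.1 // LinearIndependent F s} :=
    { toFun := fun Y => ⟨⟨Submodule.span F (Set.range Y.1.row), by
          rw [← Matrix.rank_eq_finrank_span_row]; exact Y.2⟩,
        ⟨fun i => ⟨Y.1.row i, Submodule.subset_span ⟨i, rfl⟩⟩, by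
          have h : LinearIndependent F Y.1.row := by
            rw [hspan, ← Matrix.rank_eq_finrank_span_row]; exact Y.2
          exact LinearIndependent.of_comp (Submodule.subtype _) h⟩⟩
      invFun := fun p => ⟨Matrix.of fun i => (p.2.1 i : Fin n → F), by
          rw [Matrix.rank_eq_finrank_span_row]
          exact (hspan _).1 (p.2.2.map' (Submodule.subtype _) (Submodule.ker_subtype _))⟩
      left_inv := fun Y => rfl
      right_inv := by
        rintro ⟨⟨W, hW⟩, ⟨s, hs⟩⟩
        have hW' : Submodule.span F (Set.range (fun i => (s i : Fin n → F))) = W := by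
          apply Submodule.eq_of_le_of_finrank_eq
          · rw [Submodule.span_le]
            rintro _ ⟨i, rfl⟩
            exact (s i).2
          · rw [hW]
            exact (hspan _).1 (hs.map' (Submodule.subtype _) (Submodule.ker_subtype _))
        have gen : ∀ (W' : Submodule F (Fin n → F)) (h : W' = W) (h1 : finrank F W' = m)
            (t : Fin m → W') (ht : LinearIndependent F t)
            (_ : ∀ i, (t i : Fin n → F) = s i),
            (⟨⟨W', h1⟩, ⟨t, ht⟩⟩ : Σ W : T, {s : Fin m → W.1 // LinearIndependent F s})
              = ⟨⟨W, hW⟩, ⟨s, hs⟩⟩ := by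
          intro W' h h1 t ht hh
          subst h
          have : t = s := by
            funext i; exact Subtype.ext (hh i)
          subst this
          rfl
        exact gen _ hW' _ _ _ (fun i => rfl) }
  have hfib : ∀ W : T, Nat.card {s : Fin m → W.1 // LinearIndependent F s}
      = ∏ i : Fin m, (Fintype.card F ^ m - Fintype.card F ^ (i : ℕ)) := by
    intro W
    rw [card_linearIndependent (K := F) (V := W.1) W.2.ge, W.2]
  have : Fintype T := Fintype.ofFinite T
  rw [Nat.card_congr e, Nat.card_sigma, Finset.sum_congr rfl (fun W _ => hfib W),
    Finset.sum_const, smul_eq_mul, Gq, Nat.card_eq_fintype_card]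
  rfl

theorem aux_prod (m : ℕ) (q : ℝ) :
    ∏ i ∈ Finset.range m, (q ^ m - q ^ i)
      = q ^ (m * (m - 1) / 2) * ∏ i ∈ Finset.range m, (q ^ (m - i) - 1) := by
  rw [← Finset.sum_range_id, ← Finset.prod_pow_eq_pow_sum, ← Finset.prod_mul_distrib]
  refine Finset.prod_congr rfl fun i hi => ?_
  have hi' := Finset.mem_range.1 hi
  rw [mul_sub, ← pow_add, mul_one, Nat.add_sub_cancel' hi'.le]

/-- The total left homogeneous weight of `F^{m×n}`, where the left homogeneous weight is
`w(X) = 1 − (−1)^{rank X} / ∏_{i=0}^{rank X − 1} (q^{m−i} − 1)`, equals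
`q^{mn} − (−1)^m q^{m(m+1)/2} G_q(n−1, m)`. -/
theorem stmt12 {F : Type*} [Field F] [Fintype F] [DecidableEq F] (q m n : ℕ)
    (hq : Fintype.card F = q) (hm : 0 < m) (hn : 0 < n) :
    ∑ X : Matrix (Fin m) (Fin n) F,
        (1 - (-1 : ℝ) ^ X.rank / ∏ i ∈ Finset.range X.rank, ((q : ℝ) ^ (m - i) - 1))
      = (q : ℝ) ^ (m * n) - (-1 : ℝ) ^ m * (q : ℝ) ^ (m * (m + 1) / 2) * (Gq F (n - 1) m : ℝ) := by
  classical
  obtain ⟨k, rfl⟩ : ∃ k, n = k + 1 := ⟨n - 1, by omega⟩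
  have hq1 : (1 : ℝ) < q := by
    rw [← hq]; exact_mod_cast Fintype.one_lt_card
  have hpos : ∀ i, i < m → (q : ℝ) ^ (m - i) - 1 ≠ 0 := by
    intro i hi
    have := one_lt_pow₀ hq1 (n := m - i) (by omega)
    linarith
  let f : ℕ → ℝ := fun r => (-1 : ℝ) ^ r / ∏ i ∈ Finset.range r, ((q : ℝ) ^ (m - i) - 1)
  rw [Finset.sum_sub_distrib]
  have hS := aux_sum_s12 (F := F) (m := m) (n := k) f
  have hterm : ∀ Y : Matrix (Fin m) (Fin k) F, (q : ℝ) ^ Y.rank * f Y.rank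
        + ((q : ℝ) ^ m - (q : ℝ) ^ Y.rank) * f (Y.rank + 1)
        = if Y.rank = m then (q : ℝ) ^ m * f m else 0 := by
    intro Y
    have hle : Y.rank ≤ m := by simpa using Y.rank_le_card_height
    generalize Y.rank = r at hle
    split_ifs with h
    · subst h; simp
    · have hlt : r < m := by omega
      have hne := hpos r hlt
      have hf : f (r + 1) * ((q : ℝ) ^ (m - r) - 1) = - f r := by
        simp only [f, Finset.prod_range_succ, pow_succ]
        have hne2 : ∏ i ∈ Finset.range r, ((q : ℝ) ^ (m - i) - 1) ≠ 0 :=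
          Finset.prod_ne_zero_iff.2 fun i hi => hpos i (by have := Finset.mem_range.1 hi; omega)
        field_simp
      have hqm : (q : ℝ) ^ m = q ^ r * q ^ (m - r) := by
        rw [← pow_add, Nat.add_sub_cancel' hle]
      rw [hqm]
      linear_combination (q : ℝ) ^ r * hf
  rw [hq, Finset.sum_congr rfl (fun Y _ => hterm Y), ← Finset.sum_filter, Finset.sum_const,
    nsmul_eq_mul, ← Fintype.card_subtype, ← Nat.card_eq_fintype_card, aux_count, hq] at hS
  change _ - ∑ X : Matrix (Fin m) (Fin (k + 1)) F, f X.rank = _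
  rw [hS]
  have hprod : ((∏ i : Fin m, (q ^ m - q ^ (i : ℕ)) : ℕ) : ℝ)
      = q ^ (m * (m - 1) / 2) * ∏ i ∈ Finset.range m, ((q : ℝ) ^ (m - i) - 1) := by
    rw [← aux_prod, ← Fin.prod_univ_eq_prod_range (fun i => (q : ℝ) ^ m - q ^ i), Nat.cast_prod]
    refine Finset.prod_congr rfl fun i _ => ?_
    rw [Nat.cast_sub]
    · push_cast; rfl
    · exact Nat.pow_le_pow_right (by rw [← hq]; exact Fintype.card_pos) i.2.le
  have hP : ∏ i ∈ Finset.range m, ((q : ℝ) ^ (m - i) - 1) ≠ 0 :=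
    Finset.prod_ne_zero_iff.2 fun i hi => hpos i (Finset.mem_range.1 hi)
  have hexp : m * (m + 1) / 2 = m * (m - 1) / 2 + m := by
    obtain ⟨j, rfl⟩ : ∃ j, m = j + 1 := ⟨m - 1, by omega⟩
    have : (j + 1) * (j + 1 + 1) = (j + 1) * (j + 1 - 1) + (j + 1) * 2 := by
      simp; ring
    rw [this, Nat.add_mul_div_right _ _ (by norm_num)]
  congr 1
  · have hcard : Fintype.card (Matrix (Fin m) (Fin (k + 1)) F) = q ^ (m * (k + 1)) := by
      rw [← Nat.card_eq_fintype_card]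
      change Nat.card (Fin m → Fin (k + 1) → F) = _
      simp [hq, Nat.card_eq_fintype_card]
      ring
    rw [Finset.sum_const, nsmul_eq_mul, mul_one, Finset.card_univ, hcard]
    push_cast
    rfl
  · rw [Nat.cast_mul, hprod, hexp, pow_add, Nat.add_sub_cancel]
    simp only [f]
    field_simp
end

section
/- Let F be a finite field with q elements and m, n, k positive integers with m ≤ n and 1 ≤ k ≤ m − 1. Define f : F^{m×n} → ℝ by f(X) = q^{−mn} · (1 − (−1)^{rank X} / ∏_{i=0}^{rank X − 1} (q^{n−i} − 1)) (an empty product being 1, so f(0) = 0). Then f is a probability mass function on F^{m×n} and f is k-good. (f is the normalized right homogeneous weight on F^{m×n}.) -/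
open Matrix

noncomputable def wfun (q n r : ℕ) : ℝ := (-1 : ℝ) ^ r / ∏ i ∈ Finset.range r, ((q : ℝ) ^ (n - i) - 1)

lemma wfun_succ (q n s : ℕ) (hq : 2 ≤ q) (hs : s < n) :
    (q:ℝ)^s * wfun q n s + ((q:ℝ)^n - (q:ℝ)^s) * wfun q n (s+1) = 0 := by
  have h1 : (q:ℝ)^n = (q:ℝ)^s * (q:ℝ)^(n-s) := by rw [← pow_add]; congr 1; omega
  have h2 : (1:ℝ) < (q:ℝ)^(n-s) := one_lt_pow₀ (by exact_mod_cast hq) (by omega)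
  have h3 : ((q:ℝ)^(n-s) - 1) ≠ 0 := by linarith
  unfold wfun
  rw [Finset.prod_range_succ, h1, pow_succ]
  set P := ∏ i ∈ Finset.range s, ((q : ℝ) ^ (n - i) - 1)
  have : (-1:ℝ)^s * -1 / (P * ((q:ℝ)^(n-s) - 1)) = - ((-1)^s / P) / ((q:ℝ)^(n-s) - 1) := by
    rw [div_mul_eq_div_div]; ring
  rw [this]
  field_simp
  ring

lemma wfun_le_one (q n r : ℕ) (hq : 2 ≤ q) (hr : r ≤ n) : wfun q n r ≤ 1 := by
  have hP : (1:ℝ) ≤ ∏ i ∈ Finset.range r, ((q : ℝ) ^ (n - i) - 1) := by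
    refine Finset.prod_induction _ (fun x : ℝ => 1 ≤ x)
      (fun a b ha hb => one_le_mul_of_one_le_of_one_le ha hb) le_rfl ?_
    intro i hi
    have hi := Finset.mem_range.1 hi
    have : (q:ℝ)^1 ≤ (q:ℝ)^(n-i) :=
      pow_le_pow_right₀ (by exact_mod_cast (by omega : 1 ≤ q)) (by omega)
    have h2 : (2:ℝ) ≤ q := by exact_mod_cast hq
    linarith [pow_one (q:ℝ)]
  unfold wfun
  rw [div_le_one (by linarith)]
  rcases neg_one_pow_eq_or ℝ r with h | h <;> rw [h] <;> linarith

section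
set_option linter.unusedSectionVars false
variable {F : Type*} [Field F] [Fintype F] [DecidableEq F] {m n : ℕ}

lemma row_span_eq (A : Matrix (Fin m) (Fin n) F) (u : Fin m → F) (i : Fin m) (hi : u i ≠ 0)
    (v : Fin n → F) :
    Submodule.span F (Set.range (A + vecMulVec u v).row) =
      Submodule.span F (Set.range fun j => A j - (u j / u i) • A i) ⊔
        Submodule.span F {A i + u i • v} := by
  have hrow : ∀ j, (A + vecMulVec u v).row j = A j + u j • v := by
    intro j; ext l; simp [vecMulVec_apply]
  have key : ∀ j, A j + u j • v = (A j - (u j / u i) • A i) + (u j / u i) • (A i + u i • v) := by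
    intro j; rw [smul_add, smul_smul, div_mul_cancel₀ _ hi]; abel
  apply le_antisymm
  · rw [Submodule.span_le]
    rintro _ ⟨j, rfl⟩
    rw [hrow, key j]
    exact Submodule.add_mem_sup (Submodule.subset_span ⟨j, rfl⟩)
      (Submodule.smul_mem _ _ (Submodule.mem_span_singleton_self _))
  · have hm : ∀ j, A j + u j • v ∈ Submodule.span F (Set.range (A + vecMulVec u v).row) := by
      intro j; rw [← hrow]; exact Submodule.subset_span ⟨j, rfl⟩
    refine sup_le ?_ ?_
    · rw [Submodule.span_le]
      rintro _ ⟨j, rfl⟩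
      have := Submodule.sub_mem _ (hm j) (Submodule.smul_mem _ (u j / u i) (hm i))
      rw [key j, add_sub_cancel_right] at this
      exact this
    · rw [Submodule.span_singleton_le_iff_mem]; exact hm i

lemma finrank_W (A : Matrix (Fin m) (Fin n) F) (u : Fin m → F) (i : Fin m) (hi : u i ≠ 0) :
    Module.finrank F (Submodule.span F (Set.range fun j => A j - (u j / u i) • A i)) < m := by
  have h : Submodule.span F (Set.range fun j => A j - (u j / u i) • A i) ≤
      Submodule.span F (Set.range fun j : {j // j ≠ i} => A j - (u j / u i) • A i) := by
    rw [Submodule.span_le]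
    rintro _ ⟨j, rfl⟩
    by_cases hj : j = i
    · subst hj; simp [div_self hi]
    · exact Submodule.subset_span ⟨⟨j, hj⟩, rfl⟩
  have h1 := Submodule.finrank_mono h
  have h2 := finrank_range_le_card (R := F) (fun j : {j // j ≠ i} => A j - (u j / u i) • A i)
  have h3 : Fintype.card {j // j ≠ i} = m - 1 := by simp
  have := i.pos
  unfold Set.finrank at h2
  omega

lemma finrank_sup_single {V : Type*} [AddCommGroup V] [Module F V] [FiniteDimensional F V]
    (W : Submodule F V) (x : V) (hx : x ∉ W) :
    Module.finrank F ↥(W ⊔ Submodule.span F {x}) = Module.finrank F W + 1 := by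
  have h := Submodule.finrank_sup_add_finrank_inf_eq W (Submodule.span F {x})
  have hx0 : x ≠ 0 := by rintro rfl; exact hx W.zero_mem
  have hd : Disjoint W (Submodule.span F {x}) := (Submodule.disjoint_span_singleton' hx0).2 hx
  rw [hd.eq_bot, finrank_bot, finrank_span_singleton hx0] at h
  omega

lemma line_sum (q : ℕ) (hq : Fintype.card F = q) (hmn : m ≤ n)
    (A : Matrix (Fin m) (Fin n) F) (u : Fin m → F) (hu : u ≠ 0) :
    ∑ v : Fin n → F, wfun q n (A + vecMulVec u v).rank = 0 := by
  classical
  obtain ⟨i, hi⟩ := Function.ne_iff.1 hu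
  have hi : u i ≠ 0 := hi
  set W := Submodule.span F (Set.range fun j => A j - (u j / u i) • A i) with hW
  have hs := finrank_W A u i hi
  rw [← hW] at hs
  have hq2 : 2 ≤ q := hq ▸ Fintype.one_lt_card
  let e : (Fin n → F) ≃ (Fin n → F) :=
    (LinearEquiv.smulOfNeZero F (Fin n → F) (u i) hi).toEquiv.trans (Equiv.addLeft (A i))
  have he : ∀ v, e v = A i + u i • v := fun v => rfl
  have h1 : ∀ v, wfun q n (A + vecMulVec u v).rank =
      (fun x => if x ∈ W then wfun q n (Module.finrank F W)
        else wfun q n (Module.finrank F W + 1)) (e v) := by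
    intro v
    rw [Matrix.rank_eq_finrank_span_row, row_span_eq A u i hi v, ← hW, ← he]
    dsimp only
    split_ifs with h
    · rw [sup_eq_left.2 ((Submodule.span_singleton_le_iff_mem _ _).2 h)]
    · rw [finrank_sup_single W _ h]
  rw [Finset.sum_congr rfl fun v _ => h1 v, Equiv.sum_comp e (fun x => if x ∈ W then wfun q n (Module.finrank F W)
        else wfun q n (Module.finrank F W + 1)), Finset.sum_ite]
  simp only [Finset.sum_const, nsmul_eq_mul]
  have c1 : (Finset.univ.filter fun x => x ∈ W).card = q ^ Module.finrank F W := by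
    rw [← hq, ← Module.card_eq_pow_finrank (K := F) (V := W), Fintype.card_subtype]
  have c2 := Finset.card_filter_add_card_filter_not (s := (Finset.univ : Finset (Fin n → F))) (fun x => x ∈ W)
  have c3 : (Finset.univ : Finset (Fin n → F)).card = q ^ n := by simp [hq]
  rw [c1, c3] at c2
  have c4 : (((Finset.univ.filter fun x => x ∉ W).card : ℕ) : ℝ) =
      (q:ℝ)^n - (q:ℝ)^(Module.finrank F W) := by
    rw [eq_sub_iff_add_eq']; exact_mod_cast c2
  rw [c4, c1]
  push_cast
  exact wfun_succ q n _ hq2 (by omega)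

lemma inv_sum (q : ℕ) (hq : Fintype.card F = q) (hmn : m ≤ n)
    (u : Fin m → F) (hu : u ≠ 0) (S : Finset (Matrix (Fin m) (Fin n) F))
    (hS : ∀ A v, A + vecMulVec u v ∈ S ↔ A ∈ S) :
    ∑ A ∈ S, wfun q n A.rank = 0 := by
  have h : ∀ v : Fin n → F, ∑ A ∈ S, wfun q n (A + vecMulVec u v).rank
      = ∑ A ∈ S, wfun q n A.rank := by
    intro v
    exact Finset.sum_equiv (Equiv.addRight (vecMulVec u v)) (fun A => (hS A v).symm)
      (fun A _ => rfl)
  have h2 : ∑ v : Fin n → F, ∑ A ∈ S, wfun q n (A + vecMulVec u v).rank = 0 := by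
    rw [Finset.sum_comm]
    exact Finset.sum_eq_zero fun A _ => line_sum q hq hmn A u hu
  rw [Finset.sum_congr rfl fun v _ => h v, Finset.sum_const, nsmul_eq_mul] at h2
  rcases mul_eq_zero.1 h2 with h3 | h3
  · simp at h3
  · exact h3

lemma card_mat_s13 (q : ℕ) (hq : Fintype.card F = q) (a b : ℕ) :
    Fintype.card (Matrix (Fin a) (Fin b) F) = q ^ (a * b) := by
  rw [← Nat.card_eq_fintype_card]
  change Nat.card (Fin a → Fin b → F) = _
  simp [hq, ← pow_mul, mul_comm]

lemma fiber_card (q k : ℕ) (hq : Fintype.card F = q) (M : Matrix (Fin k) (Fin m) F)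
    (hM : M.rank = k) (K : Matrix (Fin k) (Fin n) F) :
    q ^ (k * n) *
      (Finset.univ.filter fun A : Matrix (Fin m) (Fin n) F => M * A = K).card = q ^ (m * n) := by
  have hsurj : Function.Surjective M.mulVec := by
    have : LinearMap.range M.mulVecLin = ⊤ := by
      apply Submodule.eq_top_of_finrank_eq
      rw [← Matrix.rank, hM]; simp
    exact LinearMap.range_eq_top.1 this
  obtain ⟨N, hN⟩ := Matrix.mulVec_surjective_iff_exists_right_inverse.1 hsurj
  have hf : ∀ L : Matrix (Fin k) (Fin n) F,
      (Finset.univ.filter fun A : Matrix (Fin m) (Fin n) F => M * A = L).card =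
      (Finset.univ.filter fun A : Matrix (Fin m) (Fin n) F => M * A = K).card := by
    intro L
    apply Finset.card_equiv (Equiv.addRight (N * (K - L)))
    intro A
    simp [Matrix.mul_add, ← Matrix.mul_assoc, hN, ← eq_sub_iff_add_eq]
  have h := Finset.card_eq_sum_card_fiberwise (f := fun A : Matrix (Fin m) (Fin n) F => M * A)
    (s := Finset.univ) (t := Finset.univ) (by simp)
  rw [Finset.sum_congr rfl fun L _ => hf L, Finset.sum_const, smul_eq_mul] at h
  have e1 : ∀ a b : ℕ, (Finset.univ : Finset (Matrix (Fin a) (Fin b) F)).card = q ^ (a * b) := by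
    intro a b
    rw [Finset.card_univ]
    exact card_mat_s13 q hq a b
  rw [e1, e1] at h
  exact h.symm

end

/-- For `m ≤ n` and `1 ≤ k ≤ m − 1`, the normalized right homogeneous weight
`f(X) = q^{−mn} (1 − (−1)^{rank X} / ∏_{i=0}^{rank X − 1} (q^{n−i} − 1))` is a
probability mass function on `F^{m×n}` and is `k`-good. -/
theorem stmt13 {F : Type*} [Field F] [Fintype F] [DecidableEq F] (q m n k : ℕ)
    (hq : Fintype.card F = q) (hmn : m ≤ n) (hk : 1 ≤ k) (hkm : k ≤ m - 1) :
    IsPmf (fun X : Matrix (Fin m) (Fin n) F =>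
        ((q : ℝ) ^ (m * n))⁻¹ *
          (1 - (-1 : ℝ) ^ X.rank / ∏ i ∈ Finset.range X.rank, ((q : ℝ) ^ (n - i) - 1))) ∧
      IsKGood q k (fun X : Matrix (Fin m) (Fin n) F =>
        ((q : ℝ) ^ (m * n))⁻¹ *
          (1 - (-1 : ℝ) ^ X.rank / ∏ i ∈ Finset.range X.rank, ((q : ℝ) ^ (n - i) - 1))) := by
  have hq2 : 2 ≤ q := hq ▸ Fintype.one_lt_card
  have hq0 : (q:ℝ) ≠ 0 := by exact_mod_cast (by omega : q ≠ 0)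
  refine ⟨⟨fun X => ?_, ?_⟩, ?_⟩
  · have h := wfun_le_one q n X.rank hq2 ((Matrix.rank_le_width X))
    unfold wfun at h
    exact mul_nonneg (by positivity) (by linarith)
  · have h := inv_sum (F := F) (m := m) (n := n) q hq hmn (fun _ => 1)
      (Function.ne_iff.2 ⟨⟨0, by omega⟩, one_ne_zero⟩) Finset.univ (by simp)
    unfold wfun at h
    rw [← Finset.mul_sum, Finset.sum_sub_distrib, h, Finset.sum_const, Finset.card_univ,
      card_mat_s13 q hq m n]
    simp [hq0]
  · intro M hM K
    obtain ⟨u, hu, hu0⟩ := (Submodule.ne_bot_iff _).1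
      (LinearMap.ker_ne_bot_of_finrank_lt (f := M.mulVecLin) (by simp; omega))
    have hMu : M *ᵥ u = 0 := hu
    have h := inv_sum (F := F) (m := m) (n := n) q hq hmn u hu0
      (Finset.univ.filter fun A : Matrix (Fin m) (Fin n) F => M * A = K) (by
        intro A v
        simp [Matrix.mul_add, Matrix.mul_vecMulVec, hMu])
    have hc : (q:ℝ) ^ (k * n) * ((Finset.univ.filter fun A : Matrix (Fin m) (Fin n) F =>
        M * A = K).card : ℝ) = (q:ℝ) ^ (m * n) := by
      exact_mod_cast fiber_card q k hq M hM K
    unfold wfun at h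
    rw [← Finset.mul_sum, Finset.sum_sub_distrib, h, Finset.sum_const, ← hc]
    have : ((Finset.univ.filter fun A : Matrix (Fin m) (Fin n) F =>
        M * A = K).card : ℝ) ≠ 0 := by
      intro h0
      rw [h0, mul_zero] at hc
      exact pow_ne_zero _ hq0 hc.symm
    rw [nsmul_eq_mul, mul_one, sub_zero, mul_inv, mul_assoc, inv_mul_cancel₀ this, mul_one]
end

section
/- Let F be a finite field with q elements, k, m, n positive integers with k ≤ min(m,n), and f a k-good pmf on F^{m×n}. For A ∈ F^{m×n} let C(A) = {u*A : u ∈ F^m} ⊆ F^n be the linear code generated by A. Then ∑_{A : C(A) is not k-wise intersecting} f(A) ≤ (1 − (1 − 1/q)^k)^n · ∏_{i=0}^{k−1} (q^m − q^i). -/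
open Matrix

/-- A code `C ⊆ F^n` is `k`-wise intersecting if any `k` linearly independent codewords
have a common coordinate position at which they are all nonzero. -/
def KWiseIntersecting {F : Type*} [Field F] {n : ℕ} (k : ℕ) (C : Set (Fin n → F)) : Prop :=
  ∀ v : Fin k → (Fin n → F), (∀ i, v i ∈ C) → LinearIndependent F v →
    ∃ j : Fin n, ∀ i, v i j ≠ 0

lemma col_card {F : Type*} [Field F] [Fintype F] [DecidableEq F] (k : ℕ) :
    ((Finset.univ.filter fun c : Fin k → F => ∃ i, c i = 0).card : ℝ)
      = (Fintype.card F : ℝ) ^ k - ((Fintype.card F : ℝ) - 1) ^ k := by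
  have h1 := Finset.card_filter_add_card_filter_not (s := (Finset.univ : Finset (Fin k → F)))
    (fun c : Fin k → F => ∃ i, c i = 0)
  have h2 : (Finset.univ.filter fun c : Fin k → F => ¬ ∃ i, c i = 0)
      = Fintype.piFinset (fun _ : Fin k => (Finset.univ.erase (0 : F))) := by
    ext c
    simp [Fintype.mem_piFinset]
  rw [h2, Fintype.card_piFinset] at h1
  simp only [Finset.card_erase_of_mem (Finset.mem_univ (0 : F)), Finset.prod_const,
    Finset.card_univ, Fintype.card_fin, Fintype.card_pi] at h1
  have h3 : 1 ≤ Fintype.card F := Fintype.card_pos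
  have h4 := congrArg (Nat.cast : ℕ → ℝ) h1
  push_cast [Nat.cast_sub h3] at h4
  linarith

lemma bad_card {F : Type*} [Field F] [Fintype F] [DecidableEq F] (k n : ℕ) :
    ((Finset.univ.filter fun K : Matrix (Fin k) (Fin n) F => ∀ j, ∃ i, K i j = 0).card : ℝ)
      = ((Fintype.card F : ℝ) ^ k - ((Fintype.card F : ℝ) - 1) ^ k) ^ n := by
  have h : (Finset.univ.filter fun K : Matrix (Fin k) (Fin n) F => ∀ j, ∃ i, K i j = 0).card
      = (Fintype.piFinset (fun _ : Fin n =>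
          (Finset.univ.filter fun c : Fin k → F => ∃ i, c i = 0))).card := by
    refine Finset.card_bij (fun K _ => fun j i => K i j) ?_ ?_ ?_
    · intro K hK
      simpa [Fintype.mem_piFinset] using hK
    · intro K _ L _ h
      ext i j
      exact congrFun (congrFun h j) i
    · intro g hg
      have hg' : ∀ j, ∃ i, g j i = 0 := by simpa [Fintype.mem_piFinset] using hg
      exact ⟨Matrix.of fun i j => g j i, Finset.mem_filter.mpr ⟨Finset.mem_univ _, hg'⟩, rfl⟩
  rw [h, Fintype.card_piFinset]
  simp only [Finset.prod_const, Finset.card_univ, Fintype.card_fin]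
  rw [Nat.cast_pow, col_card]

/-- For a `k`-good pmf `f` on `F^{m×n}`, the probability that the linear code generated by
the random matrix is not `k`-wise intersecting is at most
`(1 − (1 − 1/q)^k)^n ∏_{i=0}^{k−1} (q^m − q^i)`. -/
theorem stmt14 {F : Type*} [Field F] [Fintype F] [DecidableEq F] (q k m n : ℕ)
    (hq : Fintype.card F = q) (hk : 0 < k) (hkm : k ≤ m) (hkn : k ≤ n)
    (f : Matrix (Fin m) (Fin n) F → ℝ) (hf : IsPmf f) (hgood : IsKGood q k f) :
    ∑ A : Matrix (Fin m) (Fin n) F,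
        Set.indicator
          {A : Matrix (Fin m) (Fin n) F |
            ¬KWiseIntersecting k {v : Fin n → F | ∃ u : Fin m → F, u ᵥ* A = v}} f A
      ≤ (1 - (1 - (q : ℝ)⁻¹) ^ k) ^ n * ∏ i ∈ Finset.range k, ((q : ℝ) ^ m - (q : ℝ) ^ i) := by
  classical
  obtain ⟨hf0, -⟩ := hf
  set LI := Finset.univ.filter fun M : Matrix (Fin k) (Fin m) F =>
    LinearIndependent F (fun i => M i) with hLI
  set N := Finset.univ.filter fun K : Matrix (Fin k) (Fin n) F => ∀ j, ∃ i, K i j = 0 with hN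
  have hq1 : 1 ≤ q := hq ▸ Fintype.card_pos
  have hq0 : (q : ℝ) ≠ 0 := by positivity
  have hcount : (LI.card : ℝ) = ∏ i ∈ Finset.range k, ((q : ℝ) ^ m - (q : ℝ) ^ i) := by
    have h := card_linearIndependent (K := F) (V := Fin m → F) (k := k) (by simpa using hkm)
    have h0 : Nat.card {s : Fin k → Fin m → F // LinearIndependent F s} = LI.card := by
      rw [Nat.card_eq_fintype_card]
      exact Fintype.card_of_subtype (p := fun s : Fin k → Fin m → F => LinearIndependent F s) LI
        (fun M => ⟨fun h => (Finset.mem_filter.mp h).2,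
          fun h => Finset.mem_filter.mpr ⟨Finset.mem_univ _, h⟩⟩)
    rw [h0] at h
    have h' : LI.card = ∏ i : Fin k, (q ^ m - q ^ (i : ℕ)) := by
      simpa [hq] using h
    rw [h', Finset.prod_range, Nat.cast_prod]
    refine Finset.prod_congr rfl fun i _ => ?_
    rw [Nat.cast_sub (Nat.pow_le_pow_right hq1 (i.2.le.trans hkm))]
    push_cast
    rfl
  have hbad : ∀ A : Matrix (Fin m) (Fin n) F,
      Set.indicator {A : Matrix (Fin m) (Fin n) F |
            ¬KWiseIntersecting k {v : Fin n → F | ∃ u : Fin m → F, u ᵥ* A = v}} f A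
      ≤ ∑ M ∈ LI, ∑ K ∈ N, if M * A = K then f A else 0 := by
    intro A
    have hnn : ∀ M ∈ LI, 0 ≤ ∑ K ∈ N, if M * A = K then f A else 0 := fun M _ =>
      Finset.sum_nonneg fun K _ => by split_ifs <;> simp [hf0]
    by_cases hA : KWiseIntersecting k {v : Fin n → F | ∃ u : Fin m → F, u ᵥ* A = v}
    · rw [Set.indicator_of_notMem (by simpa using hA)]
      exact Finset.sum_nonneg hnn
    · rw [Set.indicator_of_mem (by exact hA)]
      unfold KWiseIntersecting at hA
      push Not at hA
      obtain ⟨v, hv, hli, hz⟩ := hA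
      choose u hu using hv
      have hM : (Matrix.of u) ∈ LI := by
        simp only [hLI, Finset.mem_filter, Finset.mem_univ, true_and]
        have : LinearIndependent F ((Matrix.vecMulLinear A) ∘ u) := by
          convert hli using 1
          funext i
          exact hu i
        exact LinearIndependent.of_comp _ this
      have hMA : Matrix.of u * A = Matrix.of v := by
        ext i j
        exact congrFun (hu i) j
      have hvN : Matrix.of v ∈ N := by
        simpa [hN] using hz
      refine le_trans ?_ (Finset.single_le_sum hnn hM)
      rw [Finset.sum_ite_eq, hMA, if_pos hvN]
  calc _ ≤ ∑ A, ∑ M ∈ LI, ∑ K ∈ N, (if M * A = K then f A else 0) :=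
        Finset.sum_le_sum fun A _ => hbad A
    _ = ∑ M ∈ LI, ∑ K ∈ N, ∑ A, (if M * A = K then f A else 0) := by
        rw [Finset.sum_comm]
        exact Finset.sum_congr rfl fun M _ => Finset.sum_comm
    _ = ∑ M ∈ LI, ∑ K ∈ N, ((q : ℝ) ^ (k * n))⁻¹ := by
        refine Finset.sum_congr rfl fun M hM => Finset.sum_congr rfl fun K _ => ?_
        rw [← Finset.sum_filter]
        refine hgood M ?_ K
        have hM' : LinearIndependent F M.row := (Finset.mem_filter.mp hM).2
        simpa using hM'.rank_matrix
    _ = _ := by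
        simp only [Finset.sum_const, nsmul_eq_mul]
        rw [hcount, bad_card, hq, mul_comm, pow_mul]
        congr 1
        rw [← inv_pow, ← mul_pow]
        congr 1
        have : 1 - (q : ℝ)⁻¹ = ((q : ℝ) - 1) / q := by field_simp
        rw [this, div_pow]
        field_simp
end

section
/- Let F be a finite field with q elements, k, m, n positive integers with k ≤ min(m,n), and f a k-good pmf on F^{m×n}. Let u_1, …, u_{k+1} ∈ F^m be vectors such that u_2 − u_1, u_3 − u_1, …, u_{k+1} − u_1 are linearly independent (i.e. the points u_1, …, u_{k+1} of the affine space AG(m,F) do not lie on a common (k−1)-dimensional affine flat). Then for all vectors v_1, …, v_{k+1} ∈ F^n: ∑_{(A,w) ∈ F^{m×n} × F^n such that u_i*A + w = v_i for all i = 1,…,k+1} f(A) · q^{−n} = q^{−(k+1)n}. (This says that if Ã has distribution f and w̃ is uniform on F^n and independent of Ã, then the random vectors u_i·Ã + w̃, i = 1,…,k+1, are independent and uniform on F^n.) -/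
open Matrix

/-- If `Ã` is a `k`-good random `m×n` matrix and `w̃` is uniform on `F^n` and independent
of `Ã`, and the points `u_1, …, u_{k+1} ∈ F^m` do not lie on a common `(k−1)`-flat of
`AG(m, F)` (i.e. `u_i − u_0`, `i ≥ 1`, are linearly independent), then the random vectors
`u_i Ã + w̃` are independent and uniformly distributed over `F^n`. -/
theorem stmt15 {F : Type*} [Field F] [Fintype F] [DecidableEq F] (q k m n : ℕ)
    (hq : Fintype.card F = q) (hk : 0 < k) (hkm : k ≤ m) (hkn : k ≤ n)
    (f : Matrix (Fin m) (Fin n) F → ℝ) (hf : IsPmf f) (hgood : IsKGood q k f)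
    (u : Fin (k + 1) → (Fin m → F))
    (hu : LinearIndependent F fun i : Fin k => u i.succ - u 0) :
    ∀ v : Fin (k + 1) → (Fin n → F),
      ∑ A : Matrix (Fin m) (Fin n) F, ∑ w : Fin n → F,
          (if ∀ i : Fin (k + 1), u i ᵥ* A + w = v i then f A * ((q : ℝ) ^ n)⁻¹ else 0)
        = ((q : ℝ) ^ ((k + 1) * n))⁻¹ := by
  intro v
  have h := hgood (Matrix.of fun i : Fin k => u i.succ - u 0)
    (by simpa using LinearIndependent.rank_matrix (M := Matrix.of fun i : Fin k => u i.succ - u 0) hu)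
    (Matrix.of fun i : Fin k => v i.succ - v 0)
  have key : ∀ A : Matrix (Fin m) (Fin n) F,
      (∑ w : Fin n → F,
        (if ∀ i : Fin (k + 1), u i ᵥ* A + w = v i then f A * ((q : ℝ) ^ n)⁻¹ else 0))
      = (if (Matrix.of fun i : Fin k => u i.succ - u 0) * A
            = (Matrix.of fun i : Fin k => v i.succ - v 0) then f A else 0) * ((q : ℝ) ^ n)⁻¹ := by
    intro A
    have hiff : ((Matrix.of fun i : Fin k => u i.succ - u 0) * A
            = (Matrix.of fun i : Fin k => v i.succ - v 0)) ↔
        ∀ i : Fin (k + 1), u i ᵥ* A + (v 0 - u 0 ᵥ* A) = v i := by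
      have h1 : ((Matrix.of fun i : Fin k => u i.succ - u 0) * A
            = (Matrix.of fun i : Fin k => v i.succ - v 0)) ↔
          ∀ i : Fin k, (u i.succ - u 0) ᵥ* A = v i.succ - v 0 := by
        constructor
        · intro h i
          exact congrFun h i
        · intro h
          funext i
          exact h i
      rw [h1, Fin.forall_fin_succ]
      constructor
      · intro h
        refine ⟨by abel, fun i => ?_⟩
        have := h i
        rw [Matrix.sub_vecMul] at this
        rw [← sub_eq_zero] at this ⊢
        rw [← this]; abel
      · rintro ⟨-, h⟩ i
        have := h i
        rw [Matrix.sub_vecMul]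
        rw [← sub_eq_zero] at this ⊢
        rw [← this]; abel
    rw [Finset.sum_eq_single (v 0 - u 0 ᵥ* A)]
    · simp only [hiff, ite_mul, zero_mul]
    · intro w _ hw
      rw [if_neg]
      intro hall
      apply hw
      rw [← hall 0]; abel
    · simp
  rw [Finset.sum_congr rfl fun A _ => key A, ← Finset.sum_mul, ← Finset.sum_filter, h,
    ← mul_inv, ← pow_add, Nat.succ_mul]
end
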